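/- arXiv:math/0701940 — 2 statements merged into one kernel-verified Lean document; each statement's English description precedes it below -/
import Mathlib

section
/- Let (B,W) be a polygonal coloring of the plane with boundary ∂, and let a, b > 0 with a ≠ b. Then there exist x ∈ {a, b} and points X, Y, Z, none of which lies on ∂, all in B or all in W, with dist(X,Y) = dist(Y,Z) = dist(Z,X) = x. (In other words, no polygonal coloring can simultaneously avoid, off its boundary, monochromatic equilateral triangles of two different sizes.) -/
open scoped RealInnerProductSpace

noncomputable section

/-- `l` is an (affine) line in the plane: a nonempty one-dimensional affine subspace. -/
def IsLine (l : AffineSubspace ℝ (EuclideanSpace ℝ (Fin 2))) : Prop :=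
  (l : Set (EuclideanSpace ℝ (Fin 2))).Nonempty ∧ Module.finrank ℝ l.direction = 1

/-- A boundary segment: a closed convex subset of some affine line, containing
more than one point (it may be a segment, a ray, or a full line). -/
def IsSeg (s : Set (EuclideanSpace ℝ (Fin 2))) : Prop :=
  IsClosed s ∧ Convex ℝ s ∧ s.Nontrivial ∧
    ∃ l : AffineSubspace ℝ (EuclideanSpace ℝ (Fin 2)), IsLine l ∧ s ⊆ (l : Set _)

/-- `x` is an endpoint of the segment `s`: a point of `s` not in its relative
(intrinsic) interior. -/
def IsEndpoint (x : EuclideanSpace ℝ (Fin 2)) (s : Set (EuclideanSpace ℝ (Fin 2))) : Prop :=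
  x ∈ s ∧ x ∉ intrinsicInterior ℝ s

/-- The coloring `(B, Bᶜ)` is polygonal, with set of boundary segments `S`. -/
structure IsPolygonal (B : Set (EuclideanSpace ℝ (Fin 2)))
    (S : Set (Set (EuclideanSpace ℝ (Fin 2)))) : Prop where
  /-- The black points lie in the closure of the black interior. -/
  black_sub : B ⊆ closure (interior B)
  /-- The white points lie in the closure of the white interior. -/
  white_sub : Bᶜ ⊆ closure (interior Bᶜ)
  /-- Every member of `S` is a boundary segment. -/
  seg : ∀ s ∈ S, IsSeg s
  /-- The boundary of the coloring is the union of the boundary segments. -/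
  boundary : frontier B = ⋃₀ S
  /-- Two distinct boundary segments meet in at most one point. -/
  inter_subsingleton : ∀ s ∈ S, ∀ t ∈ S, s ≠ t → (s ∩ t).Subsingleton
  /-- A common point of two distinct boundary segments is an endpoint of both. -/
  inter_endpoint : ∀ s ∈ S, ∀ t ∈ S, s ≠ t → ∀ x ∈ s ∩ t, IsEndpoint x s ∧ IsEndpoint x t
  /-- No two distinct boundary segments sharing a common point lie on a common line. -/
  no_common_line : ∀ s ∈ S, ∀ t ∈ S, s ≠ t → (s ∩ t).Nonempty →
      ¬∃ l : AffineSubspace ℝ (EuclideanSpace ℝ (Fin 2)),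
        IsLine l ∧ s ⊆ (l : Set _) ∧ t ⊆ (l : Set _)
  /-- Every bounded region meets only finitely many boundary segments. -/
  loc_finite : ∀ R : Set (EuclideanSpace ℝ (Fin 2)), Bornology.IsBounded R →
      {s ∈ S | (s ∩ R).Nonempty}.Finite

/-- Condition (C3): every monochromatic unit triangle has a vertex on the boundary. -/
def C3 (B : Set (EuclideanSpace ℝ (Fin 2))) : Prop :=
  ∀ X Y Z : EuclideanSpace ℝ (Fin 2),
    dist X Y = 1 → dist Y Z = 1 → dist Z X = 1 →
    ((X ∈ B ∧ Y ∈ B ∧ Z ∈ B) ∨ (X ∉ B ∧ Y ∉ B ∧ Z ∉ B)) →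
    X ∈ frontier B ∨ Y ∈ frontier B ∨ Z ∈ frontier B

/-- `x` is a boundary vertex: an endpoint of some boundary segment. -/
def IsVertex (S : Set (Set (EuclideanSpace ℝ (Fin 2)))) (x : EuclideanSpace ℝ (Fin 2)) : Prop :=
  ∃ s ∈ S, IsEndpoint x s

/-- A boundary point `A` is feasible if it is not a boundary vertex and the unit
circle centered at `A` contains no boundary vertex. -/
def Feasible (B : Set (EuclideanSpace ℝ (Fin 2))) (S : Set (Set (EuclideanSpace ℝ (Fin 2))))
    (A : EuclideanSpace ℝ (Fin 2)) : Prop :=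
  A ∈ frontier B ∧ ¬IsVertex S A ∧ ∀ P ∈ Metric.sphere A 1, ¬IsVertex S P

/-- Two segments are parallel: any lines containing them have the same direction. -/
def SegParallel (s t : Set (EuclideanSpace ℝ (Fin 2))) : Prop :=
  ∀ l₁ l₂ : AffineSubspace ℝ (EuclideanSpace ℝ (Fin 2)),
    IsLine l₁ → IsLine l₂ → s ⊆ (l₁ : Set _) → t ⊆ (l₂ : Set _) →
    l₁.direction = l₂.direction

end

noncomputable section

/-- The real inner product of `n` and `x`. -/
def cdot (n x : ℂ) : ℝ := n.re * x.re + n.im * x.im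

/-- The determinant of the pair `n`, `x`. -/
def cdet (n x : ℂ) : ℝ := n.re * x.im - n.im * x.re

/-- Disjoint open sets such that every point outside both is a limit of each. -/
structure OpenColoring (U V : Set ℂ) : Prop where
  isOpen_left : IsOpen U
  isOpen_right : IsOpen V
  disjoint : Disjoint U V
  mem_closure_left : ∀ x, x ∉ U → x ∉ V → x ∈ closure U
  mem_closure_right : ∀ x, x ∉ U → x ∉ V → x ∈ closure V

/-- The region outside `U ∪ V` is locally contained in finitely many lines, and `L` collects all
these lines, encoded by a normal vector and an offset. -/
structure LocallyInLines (U V : Set ℂ) (L : Set (ℂ × ℝ)) : Prop where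
  normal_ne_zero : ∀ p ∈ L, p.1 ≠ 0
  countable : L.Countable
  locally_finite : ∀ R : ℝ, ∃ T ⊆ L, T.Finite ∧ ∀ x, ‖x‖ ≤ R → x ∉ U → x ∉ V →
    ∃ p ∈ T, cdot p.1 x = p.2

/-- The displacements of length `b` leading from `A` into `U`. -/
def circ (U : Set ℂ) (A : ℂ) (b : ℝ) : Set ℂ := {w | ‖w‖ = b ∧ A + w ∈ U}

/-- The displacements of length `b` from `A` at which both colors accumulate along the circle. -/
def changes (U V : Set ℂ) (A : ℂ) (b : ℝ) : Set ℂ :=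
  closure (circ U A b) ∩ closure (circ V A b)

/-- No equilateral triangle of side `d` lies in `U`. -/
def NoTriangle (U : Set ℂ) (d : ℝ) : Prop :=
  ∀ X Y Z : ℂ, ‖X - Y‖ = d → ‖Y - Z‖ = d → ‖Z - X‖ = d → X ∈ U → Y ∈ U → Z ∉ U

/-- The primitive sixth root of unity. -/
def sixthRoot : ℂ := ⟨1 / 2, √3 / 2⟩

lemma sixthRoot_sq : sixthRoot ^ 2 = sixthRoot - 1 := by
  have h : √3 * √3 = 3 := Real.mul_self_sqrt (by norm_num)
  apply Complex.ext <;> simp [sixthRoot, sq] <;> nlinarith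

lemma norm_eq_of_sq {z : ℂ} {r : ℝ} (hr : 0 ≤ r) (h : z.re ^ 2 + z.im ^ 2 = r ^ 2) :
    ‖z‖ = r := by
  rw [Complex.norm_eq_sqrt_sq_add_sq, h, Real.sqrt_sq hr]

lemma sq_add_sq_eq_norm_sq (z : ℂ) : z.re ^ 2 + z.im ^ 2 = ‖z‖ ^ 2 := by
  rw [Complex.sq_norm, Complex.normSq_apply]; ring

lemma norm_sixthRoot : ‖sixthRoot‖ = 1 := by
  have h : √3 * √3 = 3 := Real.mul_self_sqrt (by norm_num)
  apply norm_eq_of_sq zero_le_one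
  simp only [sixthRoot]; nlinarith

lemma norm_sixthRoot_sub_one : ‖sixthRoot - 1‖ = 1 := by
  rw [← sixthRoot_sq, norm_pow, norm_sixthRoot, one_pow]

lemma sixthRoot_pow_three : sixthRoot ^ 3 = -1 := by
  linear_combination (sixthRoot + 1) * sixthRoot_sq

lemma norm_one_sub_sixthRoot : ‖1 - sixthRoot‖ = 1 := by
  rw [norm_sub_rev, norm_sixthRoot_sub_one]

namespace OpenColoring

variable {U V : Set ℂ}

lemma symm (h : OpenColoring U V) : OpenColoring V U :=
  ⟨h.isOpen_right, h.isOpen_left, h.disjoint.symm, fun x hV hU => h.mem_closure_right x hU hV,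
    fun x hV hU => h.mem_closure_left x hU hV⟩

lemma notMem_right (h : OpenColoring U V) {x : ℂ} (hx : x ∈ U) : x ∉ V :=
  Set.disjoint_left.mp h.disjoint hx

lemma dense_union (h : OpenColoring U V) : Dense (U ∪ V) := by
  intro x
  by_cases hU : x ∈ U
  · exact subset_closure (Or.inl hU)
  by_cases hV : x ∈ V
  · exact subset_closure (Or.inr hV)
  exact closure_mono Set.subset_union_left (h.mem_closure_left x hU hV)

lemma uncountable_compl (h : OpenColoring U V) (hU : U.Nonempty) (hV : V.Nonempty) :
    ¬ (U ∪ V)ᶜ.Countable := by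
  intro hc
  have hconn := (hc.isConnected_compl_of_one_lt_rank
    (by rw [Complex.rank_real_complex]; norm_num : 1 < Module.rank ℝ ℂ)).isPreconnected
  rw [compl_compl] at hconn
  obtain ⟨x, -, hxU, hxV⟩ := hconn U V h.isOpen_left h.isOpen_right le_rfl
    (by rwa [Set.union_inter_cancel_left]) (by rwa [Set.union_inter_cancel_right])
  exact h.notMem_right hxU hxV

/-- A small common translation moves finitely many points off the boundary. -/
lemma exists_translate (h : OpenColoring U V) (F : Finset ℂ) {O : Set ℂ} (hO : IsOpen O)
    (h0 : (0 : ℂ) ∈ O) : ∃ t ∈ O, ∀ p ∈ F, p + t ∈ U ∪ V := by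
  have hd : Dense (⋂ p : F, (fun t : ℂ => (p : ℂ) + t) ⁻¹' (U ∪ V)) := by
    apply dense_iInter_of_isOpen
    · intro p
      exact (h.isOpen_left.union h.isOpen_right).preimage (by fun_prop)
    · intro p
      exact h.dense_union.preimage (Homeomorph.addLeft (p : ℂ)).isOpenMap
  obtain ⟨t, htO, ht⟩ := hd.inter_open_nonempty O hO ⟨0, h0⟩
  exact ⟨t, htO, fun p hp => Set.mem_iInter.mp ht ⟨p, hp⟩⟩

/-- If equilateral triangles with sides `a` and `b` are never monochromatic, then neither are
isosceles triangles with sides `b`, `b`, `a`. -/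
lemma noIsosceles (h : OpenColoring U V) {a b : ℝ} (hUa : NoTriangle U a) (hUb : NoTriangle U b)
    (hVa : NoTriangle V a) (hVb : NoTriangle V b) {X u v : ℂ} (hu : ‖u‖ = b) (hv : ‖v‖ = b)
    (huv : ‖u - v‖ = a) (hX : X ∈ U) (hXu : X + u ∈ U) : X + v ∉ U := by
  intro hXv
  set ω := sixthRoot with hω
  have hsq : ω ^ 2 = ω - 1 := sixthRoot_sq
  obtain ⟨t, ⟨⟨ht1, ht2⟩, ht3⟩, ht⟩ := h.exists_translate
    {X + ω * u, X + ω * v, X + ((1 - ω) * u + ω * v), X + (u - v + ω * v), X + (u + ω * v)}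
    (O := ((fun t => X + t) ⁻¹' U ∩ (fun t => X + u + t) ⁻¹' U) ∩ (fun t => X + v + t) ⁻¹' U)
    (((h.isOpen_left.preimage (by fun_prop)).inter (h.isOpen_left.preimage (by fun_prop))).inter
      (h.isOpen_left.preimage (by fun_prop)))
    (by simp [hX, hXu, hXv])
  simp only [Finset.mem_insert, Finset.mem_singleton, forall_eq_or_imp, forall_eq] at ht
  simp only [Set.mem_preimage] at ht1 ht2 ht3
  obtain ⟨hP, hQ, hR, hS, hE⟩ := ht
  have n1 : ‖ω‖ = 1 := norm_sixthRoot
  have n2 : ‖ω - 1‖ = 1 := norm_sixthRoot_sub_one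
  have side : ∀ (x y ρ d : ℂ) (r : ℝ), ‖d‖ = r → ‖ρ‖ = 1 → x - y = ρ * d → ‖x - y‖ = r := by
    intro x y ρ d r hd hρ he
    rw [he, norm_mul, hρ, hd, one_mul]
  have m1 : ‖(-1 : ℂ)‖ = 1 := by simp
  have n3 : ‖1 - ω‖ = 1 := norm_one_sub_sixthRoot
  have n4 : ‖-ω‖ = 1 := by rw [norm_neg, n1]
  have hPV := hP.resolve_left (hUb _ _ _ (side _ _ (-1) u b hu m1 (by ring))
    (side _ _ (1 - ω) u b hu n3 (by ring)) (side _ _ ω u b hu n1 (by ring)) ht1 ht2)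
  have hQV := hQ.resolve_left (hUb _ _ _ (side _ _ (-1) v b hv m1 (by ring))
    (side _ _ (1 - ω) v b hv n3 (by ring)) (side _ _ ω v b hv n1 (by ring)) ht1 ht3)
  have hRV := hR.resolve_left (hUa _ _ _ (side _ _ 1 (u - v) a huv (by simp) (by ring))
    (side _ _ (ω - 1) (u - v) a huv n2 (by ring))
    (side _ _ (-ω) (u - v) a huv n4 (by ring)) ht2 ht3)
  have hSU := hS.resolve_right (hVa _ _ _ (side _ _ ω (u - v) a huv n1 (by ring))
    (side _ _ (-1) (u - v) a huv m1 (by ring))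
    (side _ _ (1 - ω) (u - v) a huv n3 (by ring)) hPV hQV)
  have hEV := hE.resolve_left (hUb _ _ _ (side _ _ (1 - ω) v b hv n3 (by ring))
    (side _ _ (-1) v b hv m1 (by ring)) (side _ _ ω v b hv n1 (by ring)) ht2 hSU)
  exact hVb _ _ _ (side _ _ (ω - 1) u b hu n2 (by ring))
    (side _ _ (-ω) u b hu n4 (by ring)) (side _ _ 1 u b hu (by simp) (by ring)) hQV hRV hEV

lemma notMem_of_mem_changes (h : OpenColoring U V) {A w : ℂ} {b : ℝ}
    (hw : w ∈ changes U V A b) : A + w ∉ U ∧ A + w ∉ V := by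
  have key : ∀ {U V : Set ℂ}, OpenColoring U V → w ∈ closure (circ U A b) → A + w ∉ V := by
    intro U V h hw hV
    obtain ⟨y, hyV, hy⟩ := mem_closure_iff.mp hw ((fun t => A + t) ⁻¹' V)
      (h.isOpen_right.preimage (by fun_prop)) hV
    exact h.notMem_right hy.2 hyV
  exact ⟨key h.symm hw.2, key h hw.1⟩

end OpenColoring

lemma norm_eq_of_mem_closure_circ {U : Set ℂ} {A w : ℂ} {b : ℝ} (hw : w ∈ closure (circ U A b)) :
    ‖w‖ = b :=
  closure_minimal (fun _ h => h.1) (isClosed_eq continuous_norm continuous_const) hw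

lemma cdot_sq_add_cdet_sq (n x : ℂ) : cdot n x ^ 2 + cdet n x ^ 2 = ‖n‖ ^ 2 * ‖x‖ ^ 2 := by
  rw [← sq_add_sq_eq_norm_sq, ← sq_add_sq_eq_norm_sq, cdot, cdet]; ring

lemma norm_sq_pos_of_ne_zero {n : ℂ} (hn : n ≠ 0) : 0 < n.re ^ 2 + n.im ^ 2 := by
  rw [sq_add_sq_eq_norm_sq]; positivity

lemma eq_of_cdot_eq_of_cdet_eq {n x y : ℂ} (hn : n ≠ 0) (h1 : cdot n x = cdot n y)
    (h2 : cdet n x = cdet n y) : x = y := by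
  have := norm_sq_pos_of_ne_zero hn
  unfold cdot cdet at *
  apply Complex.ext
  · apply mul_left_cancel₀ this.ne'
    linear_combination n.re * h1 - n.im * h2
  · apply mul_left_cancel₀ this.ne'
    linear_combination n.im * h1 + n.re * h2

lemma eq_of_cdot_eq {n m x y : ℂ} (hnm : cdet n m ≠ 0) (h1 : cdot n x = cdot n y)
    (h2 : cdot m x = cdot m y) : x = y := by
  unfold cdot cdet at *
  apply Complex.ext
  · apply mul_left_cancel₀ hnm
    linear_combination m.im * h1 - n.im * h2
  · apply mul_left_cancel₀ hnm
    linear_combination -m.re * h1 + n.re * h2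

lemma cdot_add (n x y : ℂ) : cdot n (x + y) = cdot n x + cdot n y := by
  simp [cdot]; ring

lemma cdot_sub (n x y : ℂ) : cdot n (x - y) = cdot n x - cdot n y := by
  simp [cdot]; ring

lemma continuous_cdot (n : ℂ) : Continuous (cdot n) := by
  unfold cdot; fun_prop

/-- A circle meets a line in finitely many points. -/
lemma finite_circle_inter_line {n : ℂ} (hn : n ≠ 0) (C : ℂ) (r c : ℝ) :
    {x | ‖x - C‖ = r ∧ cdot n x = c}.Finite := by
  set d := √(‖n‖ ^ 2 * r ^ 2 - (c - cdot n C) ^ 2)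
  refine Set.Finite.of_finite_image (f := fun x => cdet n (x - C))
    ((Set.toFinite {d, -d}).subset ?_) ?_
  · rintro _ ⟨x, ⟨hx, hc⟩, rfl⟩
    have h1 := cdot_sq_add_cdet_sq n (x - C)
    rw [hx, cdot_sub, hc] at h1
    have h2 : cdet n (x - C) ^ 2 = d ^ 2 := by
      rw [Real.sq_sqrt (by nlinarith [sq_nonneg (cdet n (x - C))])]; linarith
    simpa using sq_eq_sq_iff_eq_or_eq_neg.mp h2
  · rintro x ⟨-, hx⟩ y ⟨-, hy⟩ hxy
    have := eq_of_cdot_eq_of_cdet_eq (x := x - C) (y := y - C) hn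
      (by rw [cdot_sub, cdot_sub, hx, hy]) hxy
    simpa using this

lemma LocallyInLines.finite_circle {U V : Set ℂ} {L : Set (ℂ × ℝ)} (hL : LocallyInLines U V L)
    (C : ℂ) (r : ℝ) : {x | ‖x - C‖ = r ∧ x ∉ U ∧ x ∉ V}.Finite := by
  obtain ⟨T, hTL, hT, hcov⟩ := hL.locally_finite (r + ‖C‖)
  refine (hT.biUnion fun p hp => finite_circle_inter_line (hL.normal_ne_zero p (hTL hp)) C r
    p.2).subset ?_
  rintro x ⟨hx, hU, hV⟩
  have : ‖x‖ ≤ r + ‖C‖ := by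
    rw [← hx]; simpa using norm_add_le (x - C) C
  obtain ⟨p, hp, hpx⟩ := hcov x this hU hV
  exact Set.mem_biUnion hp ⟨hx, hpx⟩

lemma LocallyInLines.symm {U V : Set ℂ} {L : Set (ℂ × ℝ)} (hL : LocallyInLines U V L) :
    LocallyInLines V U L :=
  ⟨hL.normal_ne_zero, hL.countable, fun R => by
    obtain ⟨T, hTL, hT, hcov⟩ := hL.locally_finite R
    exact ⟨T, hTL, hT, fun x hx hV hU => hcov x hx hU hV⟩⟩

/-- The points off the boundary are dense on every circle. -/
lemma LocallyInLines.mem_closure_circ {U V : Set ℂ} {L : Set (ℂ × ℝ)} (hL : LocallyInLines U V L)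
    (A : ℂ) {b : ℝ} (hb : 0 < b) {w : ℂ} (hw : ‖w‖ = b) :
    w ∈ closure (circ U A b) ∨ w ∈ closure (circ V A b) := by
  rw [← Set.mem_union, ← closure_union, mem_closure_iff_frequently]
  have hconn : IsPreconnected (Metric.sphere (0 : ℂ) b) :=
    isPreconnected_sphere (by rw [Complex.rank_real_complex]; norm_num) 0 b
  have hne : (Metric.sphere (0 : ℂ) b).Nontrivial := by
    refine ⟨b, by simp [abs_of_pos hb], -b, by simp [abs_of_pos hb], ?_⟩
    intro h
    have := congrArg Complex.re h
    simp at this; linarith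
  have hacc := accPt_iff_frequently.mp (hconn.preperfect_of_nontrivial hne w (by simpa using hw))
  have hfin : {y : ℂ | ‖y‖ = b ∧ A + y ∉ U ∧ A + y ∉ V}.Finite := by
    refine Set.Finite.of_finite_image (f := fun y => A + y)
      ((hL.finite_circle A b).subset ?_) (add_right_injective A).injOn
    rintro _ ⟨y, hy, rfl⟩
    simpa using hy
  have hev : ∀ᶠ y in nhds w, y ∉ {y : ℂ | ‖y‖ = b ∧ A + y ∉ U ∧ A + y ∉ V} \ {w} :=
    (hfin.subset Set.sdiff_subset).isClosed.isOpen_compl.mem_nhds (by simp)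
  refine (hacc.and_eventually hev).mono ?_
  rintro y ⟨⟨hyw, hy⟩, hyF⟩
  have hy' : ‖y‖ = b := by simpa using hy
  simp only [Set.mem_sdiff, Set.mem_ofPred_eq, Set.mem_singleton_iff, hyw, not_false_iff, and_true,
    hy', true_and, not_and, not_not] at hyF
  by_cases hU : A + y ∈ U
  · exact Or.inl ⟨hy', hU⟩
  · exact Or.inr ⟨hy', hyF hU⟩

lemma mem_closure_circ_of_mul {U V : Set ℂ} {L : Set (ℂ × ℝ)} (h : OpenColoring U V)
    (hL : LocallyInLines U V L) {A ρ w : ℂ} {b : ℝ} (hb : 0 < b) (hρ : ‖ρ‖ = 1)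
    (hU : ∀ w, ‖w‖ = b → A + w ∈ U → A + ρ * w ∉ U) (hw : w ∈ closure (circ U A b)) :
    ρ * w ∈ closure (circ V A b) := by
  have hρ0 : ρ ≠ 0 := by rintro rfl; simp at hρ
  suffices hsub : circ U A b ⊆ (fun w => ρ * w) ⁻¹' closure (circ V A b) from
    closure_minimal hsub (isClosed_closure.preimage (by fun_prop)) hw
  rintro w ⟨hwb, hwU⟩
  refine (hL.mem_closure_circ A hb (by rw [norm_mul, hρ, hwb, one_mul])).resolve_left ?_
  intro hcl
  obtain ⟨y, hy, hyb, hyU⟩ := mem_closure_iff.mp hcl ((fun y => A + ρ⁻¹ * y) ⁻¹' U)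
    (h.isOpen_left.preimage (by fun_prop))
    (by simpa [← mul_assoc, inv_mul_cancel₀ hρ0] using hwU)
  refine hU (ρ⁻¹ * y) (by rw [norm_mul, norm_inv, hρ, hyb]; simp) hy ?_
  rwa [← mul_assoc, mul_inv_cancel₀ hρ0, one_mul]

/-- The boundary point `A` is a limit of points of `U`, so a monochromatic pair on a circle
around `A` extends to a monochromatic isosceles triangle. -/
lemma OpenColoring.rotate_notMem {U V : Set ℂ} (h : OpenColoring U V) {A ρ w : ℂ}
    (hiso : ∀ X, X ∈ U → X + w ∈ U → X + ρ * w ∉ U) (hA : A ∉ U) (hA' : A ∉ V)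
    (hw : A + w ∈ U) : A + ρ * w ∉ U := by
  intro hρw
  obtain ⟨X, ⟨hX1, hX2⟩, hX⟩ := mem_closure_iff.mp (h.mem_closure_left A hA hA')
    ((fun X => X + w) ⁻¹' U ∩ (fun X => X + ρ * w) ⁻¹' U)
    ((h.isOpen_left.preimage (by fun_prop)).inter (h.isOpen_left.preimage (by fun_prop)))
    ⟨hw, hρw⟩
  exact hiso X hX hX1 hX2

/-- The rotations preserving the color changes on all circles of radius `b` centered on the
boundary. -/
def rotationSymmetries (U V : Set ℂ) (b : ℝ) : Submonoid ℂ where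
  carrier := {ρ | ‖ρ‖ = 1 ∧ ∀ A, A ∉ U → A ∉ V → ∀ w,
    ρ * w ∈ changes U V A b ↔ w ∈ changes U V A b}
  one_mem' := by simp
  mul_mem' := by
    rintro ρ σ ⟨hρ, hρ'⟩ ⟨hσ, hσ'⟩
    refine ⟨by rw [norm_mul, hρ, hσ, one_mul], fun A hA hA' w => ?_⟩
    rw [mul_assoc, hρ' A hA hA', hσ' A hA hA']

section Rotations

variable {U V : Set ℂ} {L : Set (ℂ × ℝ)} {a b : ℝ}

lemma mul_mem_changes (h : OpenColoring U V) (hL : LocallyInLines U V L) (hb : 0 < b)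
    (hUa : NoTriangle U a) (hUb : NoTriangle U b) (hVa : NoTriangle V a) (hVb : NoTriangle V b)
    {ρ : ℂ} (hρ : ‖ρ‖ = 1) (hρa : ‖1 - ρ‖ * b = a) {A w : ℂ} (hA : A ∉ U) (hA' : A ∉ V)
    (hw : w ∈ changes U V A b) : ρ * w ∈ changes U V A b := by
  have hd : ∀ w : ℂ, ‖w‖ = b → ‖w - ρ * w‖ = a := by
    intro w hw
    rw [← one_sub_mul, norm_mul, hw, hρa]
  have hn : ∀ w : ℂ, ‖w‖ = b → ‖ρ * w‖ = b := by
    intro w hw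
    rw [norm_mul, hρ, hw, one_mul]
  constructor
  · exact mem_closure_circ_of_mul h.symm hL.symm hb hρ (fun w hw => h.symm.rotate_notMem
      (fun X => h.symm.noIsosceles hVa hVb hUa hUb hw (hn w hw) (hd w hw)) hA' hA) hw.2
  · exact mem_closure_circ_of_mul h hL hb hρ (fun w hw => h.rotate_notMem
      (fun X => h.noIsosceles hUa hUb hVa hVb hw (hn w hw) (hd w hw)) hA hA') hw.1

lemma mem_rotationSymmetries (h : OpenColoring U V) (hL : LocallyInLines U V L) (hb : 0 < b)
    (hUa : NoTriangle U a) (hUb : NoTriangle U b) (hVa : NoTriangle V a) (hVb : NoTriangle V b)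
    {ρ : ℂ} (hρ : ‖ρ‖ = 1) (hρa : ‖1 - ρ‖ * b = a) : ρ ∈ rotationSymmetries U V b := by
  have hρ0 : ρ ≠ 0 := by rintro rfl; simp at hρ
  refine ⟨hρ, fun A hA hA' w => ⟨fun hw => ?_, fun hw => ?_⟩⟩
  · have h1 : ‖1 - ρ⁻¹‖ * b = a := by
      have : 1 - ρ⁻¹ = -(ρ⁻¹ * (1 - ρ)) := by field_simp; ring
      rw [this, norm_neg, norm_mul, norm_inv, hρ, inv_one, one_mul, hρa]
    have := mul_mem_changes h hL hb hUa hUb hVa hVb (by rw [norm_inv, hρ, inv_one]) h1 hA hA' hw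
    rwa [← mul_assoc, inv_mul_cancel₀ hρ0, one_mul] at this
  · exact mul_mem_changes h hL hb hUa hUb hVa hVb hρ hρa hA hA' hw

lemma changes_nonempty (h : OpenColoring U V) (hL : LocallyInLines U V L) (hb : 0 < b)
    (hUb : NoTriangle U b) (hVb : NoTriangle V b) {A : ℂ} (hA : A ∉ U) (hA' : A ∉ V) :
    (changes U V A b).Nonempty := by
  have hconn : IsPreconnected (Metric.sphere (0 : ℂ) b) :=
    isPreconnected_sphere (by rw [Complex.rank_real_complex]; norm_num) 0 b
  have hb' : ‖(b : ℂ)‖ = b := by simp [abs_of_pos hb]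
  have hn : ∀ w : ℂ, ‖w‖ = b → ‖sixthRoot * w‖ = b := by
    intro w hw
    rw [norm_mul, norm_sixthRoot, hw, one_mul]
  have hd : ∀ w : ℂ, ‖w‖ = b → ‖w - sixthRoot * w‖ = b := by
    intro w hw
    rw [← one_sub_mul, norm_mul, hw, norm_one_sub_sixthRoot, one_mul]
  have hrotU : ∀ {w : ℂ}, w ∈ closure (circ U A b) → sixthRoot * w ∈ closure (circ V A b) :=
    fun hw => mem_closure_circ_of_mul h hL hb norm_sixthRoot (fun w hw => h.rotate_notMem
      (fun X => h.noIsosceles hUb hUb hVb hVb hw (hn w hw) (hd w hw)) hA hA') hw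
  have hrotV : ∀ {w : ℂ}, w ∈ closure (circ V A b) → sixthRoot * w ∈ closure (circ U A b) :=
    fun hw => mem_closure_circ_of_mul h.symm hL.symm hb norm_sixthRoot
      (fun w hw => h.symm.rotate_notMem
        (fun X => h.symm.noIsosceles hVb hVb hUb hUb hw (hn w hw) (hd w hw)) hA' hA) hw
  have hmem : ∀ {w : ℂ}, ‖w‖ = b → w ∈ Metric.sphere (0 : ℂ) b := fun hw => by simpa using hw
  obtain ⟨w, -, hw⟩ := isPreconnected_closed_iff.mp hconn _ _ isClosed_closure isClosed_closure
    (fun w hw => hL.mem_closure_circ A hb (by simpa using hw))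
    (by
      rcases hL.mem_closure_circ A hb hb' with hw | hw
      · exact ⟨b, hmem hb', hw⟩
      · exact ⟨_, hmem (hn b hb'), hrotV hw⟩)
    (by
      rcases hL.mem_closure_circ A hb hb' with hw | hw
      · exact ⟨_, hmem (hn b hb'), hrotU hw⟩
      · exact ⟨b, hmem hb', hw⟩)
  exact ⟨w, hw⟩

end Rotations

/-- Near `X`, the boundary is the line through `X` with normal `n`, with `U` on the positive and
`V` on the negative side. -/
def IsFlatAt (U V : Set ℂ) (X n : ℂ) : Prop :=
  ∃ ε > 0, ∀ Y, ‖Y - X‖ < ε → (0 < cdot n (Y - X) → Y ∈ U) ∧ (cdot n (Y - X) < 0 → Y ∈ V)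

lemma cdot_neg_left (n x : ℂ) : cdot (-n) x = -cdot n x := by
  simp [cdot]; ring

lemma cdet_neg_left (n x : ℂ) : cdet (-n) x = -cdet n x := by
  simp [cdet]; ring

lemma IsFlatAt.symm {U V : Set ℂ} {X n : ℂ} (h : IsFlatAt U V X n) : IsFlatAt V U X (-n) := by
  obtain ⟨ε, hε, hY⟩ := h
  refine ⟨ε, hε, fun Y hYX => ?_⟩
  rw [cdot_neg_left, neg_pos, neg_lt_zero]
  exact (hY Y hYX).symm

lemma IsFlatAt.neg_mem_closure_circ {U V : Set ℂ} {X n w : ℂ} {b : ℝ} (h : IsFlatAt U V X n)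
    (hw : ‖w‖ = b) (hnw : cdet n w ≠ 0) : -w ∈ closure (circ U (X + w) b) := by
  obtain ⟨ε, hε, hY⟩ := h
  set q := cdet n w with hq
  let e : ℝ → ℂ := fun η => ⟨(1 - (η * q) ^ 2) / (1 + (η * q) ^ 2), 2 * (η * q) / (1 + (η * q) ^ 2)⟩
  have hpos : ∀ η : ℝ, 0 < 1 + (η * q) ^ 2 := fun η => by positivity
  have he : Continuous e := by
    have h1 : Continuous fun η : ℝ => (1 - (η * q) ^ 2) / (1 + (η * q) ^ 2) :=
      Continuous.div₀ (by fun_prop) (by fun_prop) fun η => (hpos η).ne'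
    have h2 : Continuous fun η : ℝ => 2 * (η * q) / (1 + (η * q) ^ 2) :=
      Continuous.div₀ (by fun_prop) (by fun_prop) fun η => (hpos η).ne'
    exact Complex.equivRealProdCLM.symm.continuous.comp (h1.prodMk h2)
  have he0 : e 0 = 1 := by apply Complex.ext <;> simp [e]
  have hen : ∀ η, ‖e η‖ = 1 := by
    intro η
    apply norm_eq_of_sq zero_le_one
    have := (hpos η).ne'
    simp only [e]
    field_simp
    ring
  have hlim : Filter.Tendsto (fun η => -w * e η) (nhdsWithin 0 (Set.Ioi 0)) (nhds (-w)) := by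
    have : Continuous fun η => -w * e η := by fun_prop
    have h0 := this.tendsto 0
    simp only [he0, mul_one] at h0
    exact h0.mono_left nhdsWithin_le_nhds
  refine mem_closure_of_tendsto hlim ?_
  have hsmall : ∀ᶠ η : ℝ in nhdsWithin 0 (Set.Ioi 0), ‖X + w + -w * e η - X‖ < ε := by
    have : Continuous fun η => ‖X + w + -w * e η - X‖ := by fun_prop
    have h0 := this.tendsto 0
    simp only [he0, mul_one, add_neg_cancel_right, sub_self, norm_zero] at h0
    exact (h0.eventually (gt_mem_nhds hε)).filter_mono nhdsWithin_le_nhds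
  have hfac : ∀ᶠ η : ℝ in nhdsWithin 0 (Set.Ioi 0), 0 < 1 + η * cdot n w := by
    have : Continuous fun η : ℝ => 1 + η * cdot n w := by fun_prop
    have h0 := this.tendsto 0
    simp only [zero_mul, add_zero] at h0
    exact (h0.eventually (lt_mem_nhds one_pos)).filter_mono nhdsWithin_le_nhds
  filter_upwards [hsmall, hfac, self_mem_nhdsWithin] with η h1 h2 h3
  have hη : 0 < η := h3
  refine ⟨by rw [norm_mul, hen, norm_neg, hw, mul_one], (hY _ h1).1 ?_⟩
  have hform : cdot n (X + w + -w * e η - X) =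
      2 * η * q ^ 2 * (1 + η * cdot n w) / (1 + (η * q) ^ 2) := by
    have := (hpos η).ne'
    rw [eq_div_iff this]
    simp only [cdot, e, Complex.sub_re, Complex.sub_im, Complex.add_re, Complex.add_im,
      Complex.mul_re, Complex.mul_im, Complex.neg_re, Complex.neg_im]
    field_simp
    rw [hq, cdet]
    ring
  rw [hform]
  have : 0 < q ^ 2 := by positivity
  have := hpos η
  positivity

lemma IsFlatAt.neg_mem_changes {U V : Set ℂ} {X n w : ℂ} {b : ℝ} (h : IsFlatAt U V X n)
    (hw : ‖w‖ = b) (hnw : cdet n w ≠ 0) : -w ∈ changes U V (X + w) b :=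
  ⟨h.neg_mem_closure_circ hw hnw,
    h.symm.neg_mem_closure_circ hw (by rwa [cdet_neg_left, neg_ne_zero])⟩

/-- If the circle around `X` is tangent to the boundary at the flat boundary point `X + w`, with `V`
inside, then `U` does not accumulate at `X + w` along the circle. -/
lemma IsFlatAt.notMem_closure_circ {U V : Set ℂ} (hUV : OpenColoring U V) {X n w : ℂ} {b : ℝ}
    (h : IsFlatAt U V (X + w) n) (hw : ‖w‖ = b) (hXw : X + w ∉ U) (hnw : cdet n w = 0)
    (hpos : 0 < cdot n w) : w ∉ closure (circ U X b) := by
  intro hcl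
  obtain ⟨ε, hε, hY⟩ := h
  obtain ⟨y, hy, hyb, hyU⟩ := mem_closure_iff.mp hcl (Metric.ball w ε) Metric.isOpen_ball
    (Metric.mem_ball_self hε)
  have hn : n ≠ 0 := by rintro rfl; simp [cdot] at hpos
  have h1 := cdot_sq_add_cdet_sq n w
  have h2 := cdot_sq_add_cdet_sq n y
  rw [hnw, hw] at h1
  rw [hyb] at h2
  have hdiff : X + y - (X + w) = y - w := by ring
  have hnot : ¬ cdot n (y - w) < 0 := by
    intro hlt
    refine hUV.notMem_right hyU ((hY (X + y) ?_).2 ?_)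
    · rw [hdiff]; simpa [dist_eq_norm] using hy
    · rwa [hdiff]
  rw [cdot_sub, not_lt, sub_nonneg] at hnot
  have hdet : cdet n y = 0 := by
    have : cdet n y ^ 2 ≤ 0 := by nlinarith
    simpa using this
  have hdot : cdot n y = cdot n w := by
    rw [hdet] at h2
    nlinarith
  have := eq_of_cdot_eq_of_cdet_eq hn hdot (hdet.trans hnw.symm)
  rw [this] at hyU
  exact hXw hyU

lemma IsFlatAt.cdet_ne_zero {U V : Set ℂ} (hUV : OpenColoring U V) {X n w : ℂ} {b : ℝ}
    (hb : 0 < b) (hn : n ≠ 0) (h : IsFlatAt U V (X + w) n) (hw : w ∈ changes U V X b) :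
    cdet n w ≠ 0 := by
  intro h0
  have hwb := norm_eq_of_mem_closure_circ hw.1
  obtain ⟨hXU, hXV⟩ := hUV.notMem_of_mem_changes hw
  rcases lt_trichotomy (cdot n w) 0 with hlt | heq | hgt
  · exact h.symm.notMem_closure_circ hUV.symm hwb hXV (by rw [cdet_neg_left, h0, neg_zero])
      (by rw [cdot_neg_left]; linarith) hw.2
  · have h1 := cdot_sq_add_cdet_sq n w
    rw [h0, heq, hwb] at h1
    have : 0 < ‖n‖ := norm_pos_iff.mpr hn
    have : 0 < ‖n‖ ^ 2 * b ^ 2 := by positivity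
    linarith
  · exact h.notMem_closure_circ hUV hwb hXU h0 hgt hw.1

/-- The two sides of a boundary line are not both in `U`. -/
lemma OpenColoring.not_both_sides {U V : Set ℂ} (h : OpenColoring U V) {X n : ℂ} (hn : n ≠ 0)
    (hU : X ∉ U) (hV : X ∉ V) {ε : ℝ} (hε : 0 < ε)
    (h1 : ∀ Y, ‖Y - X‖ < ε → 0 < cdot n (Y - X) → Y ∈ U)
    (h2 : ∀ Y, ‖Y - X‖ < ε → cdot n (Y - X) < 0 → Y ∈ U) : False := by
  obtain ⟨y, hy, hyV⟩ := mem_closure_iff.mp (h.mem_closure_right X hU hV) (Metric.ball X ε)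
    Metric.isOpen_ball (Metric.mem_ball_self hε)
  have hline : ∀ z ∈ Metric.ball X ε ∩ V, cdot n (z - X) = 0 := by
    rintro z ⟨hz, hzV⟩
    rw [Metric.mem_ball, dist_eq_norm] at hz
    by_contra hne
    rcases lt_or_gt_of_ne hne with hlt | hgt
    · exact h.notMem_right (h2 z hz hlt) hzV
    · exact h.notMem_right (h1 z hz hgt) hzV
  have hev : ∀ᶠ t : ℝ in nhdsWithin 0 (Set.Ioi 0), y + t * n ∈ Metric.ball X ε ∩ V := by
    have hc : Continuous fun t : ℝ => y + t * n := by fun_prop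
    have h0 := hc.tendsto 0
    simp only [Complex.ofReal_zero, zero_mul, add_zero] at h0
    exact (h0.eventually ((Metric.isOpen_ball.inter h.isOpen_right).mem_nhds
      ⟨hy, hyV⟩)).filter_mono nhdsWithin_le_nhds
  obtain ⟨t, ht, ht0⟩ := (hev.and self_mem_nhdsWithin).exists
  have e1 := hline _ ht
  have e2 := hline y ⟨hy, hyV⟩
  have ht0 : 0 < t := ht0
  have hpos := norm_sq_pos_of_ne_zero hn
  have : cdot n (y + t * n - X) = cdot n (y - X) + t * (n.re ^ 2 + n.im ^ 2) := by
    simp [cdot]; ring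
  rw [e1, e2, zero_add] at this
  have := mul_pos ht0 hpos
  linarith

lemma convex_half_ball (X n : ℂ) (ε : ℝ) :
    Convex ℝ {Y | ‖Y - X‖ < ε ∧ 0 < cdot n (Y - X)} := by
  have h1 : {Y | ‖Y - X‖ < ε ∧ 0 < cdot n (Y - X)} =
      Metric.ball X ε ∩ {Y | cdot n X < cdot n Y} := by
    ext Y
    simp [dist_eq_norm, cdot_sub]
  rw [h1]
  refine (convex_ball X ε).inter (convex_halfSpace_gt (f := cdot n) ⟨cdot_add n, ?_⟩ _)
  intro c x
  simp [cdot]; ring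

/-- A boundary point at which only parallel lines meet is flat. -/
lemma LocallyInLines.isFlatAt {U V : Set ℂ} {L : Set (ℂ × ℝ)} (hL : LocallyInLines U V L)
    (h : OpenColoring U V) {X : ℂ} (hU : X ∉ U) (hV : X ∉ V) {n : ℂ} (hn : n ≠ 0)
    (hpar : ∀ q ∈ L, cdot q.1 X = q.2 → cdet n q.1 = 0) :
    IsFlatAt U V X n ∨ IsFlatAt U V X (-n) := by
  obtain ⟨T, hTL, hT, hcov⟩ := hL.locally_finite (‖X‖ + 1)
  have hev : ∀ᶠ Y in nhds X, ∀ q ∈ {q ∈ T | cdot q.1 X ≠ q.2}, cdot q.1 Y ≠ q.2 := by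
    rw [Filter.eventually_all_finite (hT.subset (Set.sep_subset _ _))]
    rintro q ⟨-, hq⟩
    exact (continuous_cdot q.1).continuousAt.eventually_ne hq
  obtain ⟨ε₀, hε₀, hball⟩ := Metric.eventually_nhds_iff.mp hev
  set ε := min ε₀ 1
  have hε : 0 < ε := lt_min hε₀ one_pos
  have hoff : ∀ Y, ‖Y - X‖ < ε → cdot n (Y - X) ≠ 0 → Y ∈ U ∪ V := by
    intro Y hY hne
    by_contra hUV
    rw [Set.mem_union, not_or] at hUV
    have hYR : ‖Y‖ ≤ ‖X‖ + 1 := by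
      have h1 := norm_add_le X (Y - X)
      rw [add_sub_cancel] at h1
      have h2 : ε ≤ 1 := min_le_right _ _
      linarith
    obtain ⟨q, hq, hqY⟩ := hcov Y hYR hUV.1 hUV.2
    have hqX : cdot q.1 X = q.2 := by
      by_contra hqX
      refine hball ?_ q ⟨hq, hqX⟩ hqY
      rw [dist_eq_norm]
      exact hY.trans_le (min_le_left _ _)
    have hpq := hpar q (hTL hq) hqX
    have hq0 : cdot q.1 (Y - X) = 0 := by rw [cdot_sub, hqX, hqY, sub_self]
    have hpos := norm_sq_pos_of_ne_zero (hL.normal_ne_zero q (hTL hq))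
    apply hne
    apply mul_left_cancel₀ hpos.ne'
    unfold cdot cdet at *
    linear_combination (n.re * q.1.re + n.im * q.1.im) * hq0
      + (-q.1.re * (Y - X).im + q.1.im * (Y - X).re) * hpq
  have hside : ∀ m : ℂ, (∀ Y, ‖Y - X‖ < ε → cdot m (Y - X) ≠ 0 → Y ∈ U ∪ V) →
      (∀ Y, ‖Y - X‖ < ε → 0 < cdot m (Y - X) → Y ∈ U) ∨
      (∀ Y, ‖Y - X‖ < ε → 0 < cdot m (Y - X) → Y ∈ V) := by
    intro m hm
    have hsub : {Y | ‖Y - X‖ < ε ∧ 0 < cdot m (Y - X)} ⊆ U ∪ V :=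
      fun Y hY => hm Y hY.1 hY.2.ne'
    rcases (convex_half_ball X m ε).isPreconnected.subset_or_subset h.isOpen_left
      h.isOpen_right h.disjoint hsub with hs | hs
    · exact Or.inl fun Y h1 h2 => hs ⟨h1, h2⟩
    · exact Or.inr fun Y h1 h2 => hs ⟨h1, h2⟩
  have hneg := hside (-n) fun Y hY hne => hoff Y hY (by rwa [cdot_neg_left, neg_ne_zero] at hne)
  simp only [cdot_neg_left, neg_pos] at hneg
  rcases hside n hoff with hp | hp <;> rcases hneg with hm | hm
  · exact (h.not_both_sides hn hU hV hε hp hm).elim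
  · exact Or.inl ⟨ε, hε, fun Y hY => ⟨hp Y hY, hm Y hY⟩⟩
  · refine Or.inr (IsFlatAt.symm ⟨ε, hε, fun Y hY => ⟨hp Y hY, hm Y hY⟩⟩)
  · exact (h.symm.not_both_sides hn hV hU hε hp hm).elim

lemma finite_norm_eq_of_cdet_mul_eq_zero {n g : ℂ} (hn : n ≠ 0) (hg : g ≠ 0) (b : ℝ) :
    {w | ‖w‖ = b ∧ cdet n (g * w) = 0}.Finite := by
  have hm : starRingEnd ℂ g * (Complex.I * n) ≠ 0 := by simp [hn, hg]
  refine (finite_circle_inter_line hm 0 b 0).subset ?_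
  rintro w ⟨hw, h0⟩
  refine ⟨by simpa using hw, ?_⟩
  rw [← h0]
  simp [cdot, cdet]
  ring

/-- A boundary point whose translates by `z * w`, where `‖w‖ = b` and `z ∈ K`, are not on two
nonparallel boundary lines, and such that no step `g * w` with `g ∈ K` along the normal of the
boundary line at one translate leads to a nonparallel boundary line. -/
structure IsGeneric (L : Set (ℂ × ℝ)) (K : Set ℂ) (b : ℝ) (A : ℂ) : Prop where
  not_crossing : ∀ z ∈ K, ∀ p ∈ L, ∀ q ∈ L, cdet p.1 q.1 ≠ 0 → ∀ w, ‖w‖ = b →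
    cdot p.1 (A + z * w) = p.2 → cdot q.1 (A + z * w) ≠ q.2
  not_normal : ∀ z ∈ K, ∀ g ∈ K, g ≠ 0 → ∀ p ∈ L, ∀ q ∈ L, cdet p.1 q.1 ≠ 0 → ∀ w, ‖w‖ = b →
    cdet p.1 (g * w) = 0 → cdot p.1 (A + z * w) = p.2 → cdot q.1 (A + (z + g) * w) ≠ q.2

section Generic

variable {U V : Set ℂ} {L : Set (ℂ × ℝ)} {b : ℝ}

lemma finite_crossing (hL : LocallyInLines U V L) (z : ℂ) {p q : ℂ × ℝ}
    (hpq : cdet p.1 q.1 ≠ 0) :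
    {A | (A ∉ U ∧ A ∉ V) ∧ ∃ w, ‖w‖ = b ∧ cdot p.1 (A + z * w) = p.2 ∧
      cdot q.1 (A + z * w) = q.2}.Finite := by
  rcases Set.eq_empty_or_nonempty {A | (A ∉ U ∧ A ∉ V) ∧ ∃ w, ‖w‖ = b ∧
      cdot p.1 (A + z * w) = p.2 ∧ cdot q.1 (A + z * w) = q.2} with he | ⟨A₀, -, w₀, -, hp₀, hq₀⟩
  · rw [he]; exact Set.finite_empty
  refine (hL.finite_circle (A₀ + z * w₀) (‖z‖ * b)).subset ?_
  rintro A ⟨hA, w, hw, hp, hq⟩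
  have := eq_of_cdot_eq hpq (hp.trans hp₀.symm) (hq.trans hq₀.symm)
  refine ⟨?_, hA⟩
  rw [← this, ← hw, ← norm_mul, ← norm_neg]
  congr 1
  ring

lemma finite_normal {p q : ℂ × ℝ} (hp : p.1 ≠ 0) (z : ℂ) {g : ℂ} (hg : g ≠ 0)
    (hpq : cdet p.1 q.1 ≠ 0) :
    {A | ∃ w, ‖w‖ = b ∧ cdet p.1 (g * w) = 0 ∧ cdot p.1 (A + z * w) = p.2 ∧
      cdot q.1 (A + (z + g) * w) = q.2}.Finite := by
  refine ((finite_norm_eq_of_cdet_mul_eq_zero hp hg b).biUnion (t := fun w =>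
    {A | cdot p.1 (A + z * w) = p.2 ∧ cdot q.1 (A + (z + g) * w) = q.2}) fun w _ => ?_).subset ?_
  · apply Set.Subsingleton.finite
    rintro A ⟨h1, h2⟩ A' ⟨h1', h2'⟩
    rw [cdot_add] at h1 h2 h1' h2'
    exact eq_of_cdot_eq hpq (by linarith) (by linarith)
  · rintro A ⟨w, hw, h0, h1, h2⟩
    exact Set.mem_biUnion (show w ∈ {w | ‖w‖ = b ∧ cdet p.1 (g * w) = 0} from ⟨hw, h0⟩) ⟨h1, h2⟩

lemma exists_isGeneric (h : OpenColoring U V) (hL : LocallyInLines U V L) (hU : U.Nonempty)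
    (hV : V.Nonempty) {K : Set ℂ} (hK : K.Countable) :
    ∃ A, A ∉ U ∧ A ∉ V ∧ IsGeneric L K b A := by
  by_contra! hcon
  apply h.uncountable_compl hU hV
  set pairs := {pq : (ℂ × ℝ) × (ℂ × ℝ) | pq ∈ L ×ˢ L ∧ cdet pq.1.1 pq.2.1 ≠ 0}
  have hpairs : pairs.Countable := (hL.countable.prod hL.countable).mono fun _ h => h.1
  have c1 : (⋃ z ∈ K, ⋃ pq ∈ pairs, {A | (A ∉ U ∧ A ∉ V) ∧ ∃ w, ‖w‖ = b ∧
      cdot pq.1.1 (A + z * w) = pq.1.2 ∧ cdot pq.2.1 (A + z * w) = pq.2.2}).Countable :=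
    hK.biUnion fun z _ => hpairs.biUnion fun pq hpq => (finite_crossing hL z hpq.2).countable
  have c2 : (⋃ z ∈ K, ⋃ g ∈ K \ {0}, ⋃ pq ∈ pairs, {A | ∃ w, ‖w‖ = b ∧ cdet pq.1.1 (g * w) = 0 ∧
      cdot pq.1.1 (A + z * w) = pq.1.2 ∧ cdot pq.2.1 (A + (z + g) * w) = pq.2.2}).Countable :=
    hK.biUnion fun z _ => (hK.mono Set.sdiff_subset).biUnion fun g hg => hpairs.biUnion
      fun pq hpq => (finite_normal (hL.normal_ne_zero _ hpq.1.1) z hg.2 hpq.2).countable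
  refine (c1.union c2).mono ?_
  intro A hA
  rw [Set.mem_compl_iff, Set.mem_union, not_or] at hA
  by_contra hno
  simp only [Set.mem_union, Set.mem_iUnion, not_or, not_exists] at hno
  refine hcon A hA.1 hA.2 ⟨?_, ?_⟩
  · intro z hz p hp q hq hpq w hw h1 h2
    exact hno.1 z hz (p, q) ⟨⟨hp, hq⟩, hpq⟩ ⟨hA, w, hw, h1, h2⟩
  · intro z hz g hg hg0 p hp q hq hpq w hw h0 h1 h2
    exact hno.2 z hz g ⟨hg, hg0⟩ (p, q) ⟨⟨hp, hq⟩, hpq⟩ ⟨w, hw, h0, h1, h2⟩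

lemma cdet_eq_zero_of_parallel {n m x : ℂ} (hn : n ≠ 0) (hnm : cdet n m = 0)
    (hx : cdet n x = 0) : cdet m x = 0 := by
  have hpos := norm_sq_pos_of_ne_zero hn
  apply mul_left_cancel₀ hpos.ne'
  unfold cdet at *
  linear_combination (m.re * n.re + m.im * n.im) * hx - (n.re * x.re + n.im * x.im) * hnm

lemma LocallyInLines.exists_line (hL : LocallyInLines U V L) {X : ℂ} (hU : X ∉ U) (hV : X ∉ V) :
    ∃ p ∈ L, cdot p.1 X = p.2 := by
  obtain ⟨T, hTL, -, hT⟩ := hL.locally_finite ‖X‖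
  obtain ⟨p, hp, hpX⟩ := hT X le_rfl hU hV
  exact ⟨p, hTL hp, hpX⟩

lemma IsGeneric.mem_changes_step (h : OpenColoring U V) (hL : LocallyInLines U V L) (hb : 0 < b)
    {K : Subfield ℂ} {A w : ℂ} (hA : IsGeneric L K b A) {z g : ℂ} (hz : z ∈ K) (hg : g ∈ K)
    (hg' : g ∈ rotationSymmetries U V b) (hg'' : -g ∈ rotationSymmetries U V b)
    (hU : A + z * w ∉ U) (hV : A + z * w ∉ V) (hw : w ∈ changes U V (A + z * w) b) :
    A + (z + g) * w ∉ U ∧ A + (z + g) * w ∉ V ∧ w ∈ changes U V (A + (z + g) * w) b := by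
  have hwb : ‖w‖ = b := norm_eq_of_mem_closure_circ hw.1
  have hg0 : g ≠ 0 := by
    rintro rfl
    simpa using hg'.1
  have hgw : g * w ∈ changes U V (A + z * w) b := (hg'.2 _ hU hV w).mpr hw
  have hX : A + (z + g) * w = A + z * w + g * w := by ring
  obtain ⟨hU', hV'⟩ := h.notMem_of_mem_changes hgw
  rw [← hX] at hU' hV'
  have hflat : ∀ z ∈ K, ∀ p ∈ L, A + z * w ∉ U → A + z * w ∉ V → cdot p.1 (A + z * w) = p.2 →
      IsFlatAt U V (A + z * w) p.1 ∨ IsFlatAt U V (A + z * w) (-p.1) := by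
    intro z hz p hp hU hV hpX
    refine hL.isFlatAt h hU hV (hL.normal_ne_zero p hp) fun q hq hqX => ?_
    by_contra hpq
    exact hA.not_crossing z hz p hp q hq hpq w hwb hpX hqX
  obtain ⟨p, hp, hpX⟩ := hL.exists_line hU hV
  obtain ⟨q, hq, hqX⟩ := hL.exists_line hU' hV'
  have hqn : cdet q.1 (g * w) ≠ 0 := by
    have hq0 := hL.normal_ne_zero q hq
    have hf := hflat (z + g) (K.add_mem hz hg) q hq hU' hV' hqX
    rw [hX] at hf
    rcases hf with hf | hf
    · exact hf.cdet_ne_zero h hb hq0 hgw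
    · have := hf.cdet_ne_zero h hb (neg_ne_zero.mpr hq0) hgw
      rwa [cdet_neg_left, neg_ne_zero] at this
  have hpn : cdet p.1 (g * w) ≠ 0 := by
    intro h0
    by_cases hpq : cdet p.1 q.1 = 0
    · exact hqn (cdet_eq_zero_of_parallel (hL.normal_ne_zero p hp) hpq h0)
    · exact hA.not_normal z hz g hg hg0 p hp q hq hpq w hwb h0 hpX hqX
  have hgwb : ‖g * w‖ = b := by rw [norm_mul, hg'.1, hwb, one_mul]
  have hneg : -(g * w) ∈ changes U V (A + z * w + g * w) b := by
    rcases hflat z hz p hp hU hV hpX with hf | hf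
    · exact hf.neg_mem_changes hgwb hpn
    · exact hf.neg_mem_changes hgwb (by rwa [cdet_neg_left, neg_ne_zero])
  rw [← hX, ← neg_mul] at hneg
  exact ⟨hU', hV', (hg''.2 _ hU' hV' w).mp hneg⟩

lemma neg_one_mem_rotationSymmetries (hω : sixthRoot ∈ rotationSymmetries U V b) :
    (-1 : ℂ) ∈ rotationSymmetries U V b := by
  rw [← sixthRoot_pow_three]
  exact pow_mem hω 3

/-- From a generic boundary point, all points reached through the ring generated by rotational
symmetries are boundary points. -/
lemma IsGeneric.notMem_of_mem_closure (h : OpenColoring U V) (hL : LocallyInLines U V L)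
    (hb : 0 < b) {s : Set ℂ} {A w : ℂ} (hA : IsGeneric L (Subfield.closure s) b A)
    (hs : s ⊆ rotationSymmetries U V b) (hω : sixthRoot ∈ rotationSymmetries U V b)
    (hU : A ∉ U) (hV : A ∉ V) (hw : w ∈ changes U V A b) {m : ℂ} (hm : m ∈ Subring.closure s) :
    A + m * w ∉ U ∧ A + m * w ∉ V := by
  set K := Subfield.closure s
  let P : ℂ → Prop := fun z => A + z * w ∉ U ∧ A + z * w ∉ V ∧ w ∈ changes U V (A + z * w) b
  have hN : ∀ g ∈ Submonoid.closure s, g ∈ rotationSymmetries U V b ∧ g ∈ K := fun g hg =>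
    ⟨Submonoid.closure_le.mpr hs hg,
      Submonoid.closure_le (S := K.toSubmonoid).mpr Subfield.subset_closure hg⟩
  have hneg : ∀ g ∈ rotationSymmetries U V b, -g ∈ rotationSymmetries U V b := by
    intro g hg
    rw [← neg_one_mul]
    exact mul_mem (neg_one_mem_rotationSymmetries hω) hg
  have key : m ∈ K ∧ ∀ z ∈ K, P z ↔ P (z + m) := by
    rw [Subring.mem_closure_iff] at hm
    induction hm using AddSubgroup.closure_induction with
    | mem g hg =>
      obtain ⟨hgH, hgK⟩ := hN g hg
      refine ⟨hgK, fun z hz => ⟨fun ⟨h1, h2, h3⟩ => hA.mem_changes_step h hL hb hz hgK hgH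
        (hneg g hgH) h1 h2 h3, fun ⟨h1, h2, h3⟩ => ?_⟩⟩
      have := hA.mem_changes_step h hL hb (K.add_mem hz hgK) (K.neg_mem hgK) (hneg g hgH)
        (by rwa [neg_neg]) h1 h2 h3
      rwa [add_neg_cancel_right] at this
    | zero => exact ⟨K.zero_mem, fun z _ => by rw [add_zero]⟩
    | add x y _ _ hx hy =>
      refine ⟨K.add_mem hx.1 hy.1, fun z hz => ?_⟩
      rw [hx.2 z hz, hy.2 (z + x) (K.add_mem hz hx.1), add_assoc]
    | neg x _ hx =>
      refine ⟨K.neg_mem hx.1, fun z hz => ?_⟩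
      rw [hx.2 (z + -x) (K.add_mem hz (K.neg_mem hx.1)), neg_add_cancel_right]
  have h0 : P 0 := by simpa [P] using ⟨hU, hV, hw⟩
  have := (key.2 0 K.zero_mem).mp h0
  rw [zero_add] at this
  exact ⟨this.1, this.2.1⟩

end Generic

/-- Every complex number is within distance one of the Eisenstein integers. -/
lemma exists_eisenstein_near (y : ℂ) : ∃ i j : ℤ, ‖y - (i + j * sixthRoot)‖ ≤ 1 := by
  obtain ⟨t, ht⟩ : ∃ t : ℝ, t * (√3 / 2) = y.im :=
    ⟨y.im / (√3 / 2), div_mul_cancel₀ _ (by positivity)⟩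
  set s := y.re - t / 2 with hs
  have hy : y = s + t * sixthRoot := by
    apply Complex.ext
    · simp [sixthRoot, hs]; ring
    · simp [sixthRoot]; linarith
  refine ⟨round s, round t, ?_⟩
  have : y - (round s + round t * sixthRoot) =
      ((s - round s : ℝ) : ℂ) + ((t - round t : ℝ) : ℂ) * sixthRoot := by
    push_cast; linear_combination hy
  rw [this]
  refine (norm_add_le _ _).trans ?_
  rw [norm_mul, norm_sixthRoot, mul_one, Complex.norm_real, Complex.norm_real, Real.norm_eq_abs,
    Real.norm_eq_abs]
  linarith [abs_sub_round s, abs_sub_round t]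

/-- The rotation by the apex angle of the isosceles triangle with legs `1` and base `s < 1` is
closer to the rotation by sixty degrees than one. -/
lemma exists_apex_rotation {s : ℝ} (hs : 0 < s) (hs1 : s < 1) :
    ∃ σ : ℂ, ‖σ‖ = 1 ∧ ‖1 - σ‖ = s ∧ sixthRoot - σ ≠ 0 ∧ ‖sixthRoot - σ‖ < 1 := by
  have hpos : 0 < 1 - s ^ 2 / 4 := by nlinarith
  set c := √(1 - s ^ 2 / 4) with hc
  have hc0 : 0 < c := Real.sqrt_pos.mpr hpos
  have hc2 : c ^ 2 = 1 - s ^ 2 / 4 := Real.sq_sqrt hpos.le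
  have h3 : √3 ^ 2 = 3 := Real.sq_sqrt (by norm_num)
  have h30 : 0 < √3 := by positivity
  refine ⟨⟨1 - s ^ 2 / 2, s * c⟩, ?_, ?_, ?_, ?_⟩
  · apply norm_eq_of_sq zero_le_one
    simp only
    rw [mul_pow, hc2]; ring
  · apply norm_eq_of_sq hs.le
    simp only [Complex.sub_re, Complex.sub_im, Complex.one_re, Complex.one_im]
    rw [zero_sub, neg_sq, mul_pow, hc2]; ring
  · intro h
    have := congrArg Complex.re h
    simp only [sixthRoot, Complex.sub_re, Complex.zero_re] at this
    nlinarith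
  · have hlt : s < 2 * (√3 * c) := by
      apply lt_of_pow_lt_pow_left₀ 2 (by positivity)
      rw [mul_pow, mul_pow, h3, hc2]
      nlinarith
    rw [← sq_lt_one_iff₀ (norm_nonneg _), ← sq_add_sq_eq_norm_sq]
    simp only [sixthRoot, Complex.sub_re, Complex.sub_im]
    nlinarith [mul_pos hs (sub_pos.mpr hlt)]

lemma exists_triangle {d : ℝ} (hd : 0 < d) {U : Set ℂ} (hU : U = Set.univ) :
    ¬ NoTriangle U d := by
  intro h
  have hd' : ‖(d : ℂ)‖ = d := by simp [abs_of_pos hd]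
  refine h 0 d (sixthRoot * d) (by rw [zero_sub, norm_neg, hd']) ?_ ?_ ?_ ?_ ?_
  · rw [← one_sub_mul, norm_mul, norm_one_sub_sixthRoot, hd', one_mul]
  · rw [sub_zero, norm_mul, norm_sixthRoot, hd', one_mul]
  all_goals simp [hU]

theorem false_of_noTriangle {U V : Set ℂ} {L : Set (ℂ × ℝ)} (h : OpenColoring U V)
    (hL : LocallyInLines U V L) {a b : ℝ} (ha : 0 < a) (hab : a < b) (hUa : NoTriangle U a)
    (hUb : NoTriangle U b) (hVa : NoTriangle V a) (hVb : NoTriangle V b) : False := by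
  have hb : 0 < b := ha.trans hab
  have hnonempty : ∀ {U V : Set ℂ}, OpenColoring U V → NoTriangle U a → V.Nonempty := by
    intro U V h hU
    by_contra hV
    rw [Set.not_nonempty_iff_eq_empty] at hV
    refine exists_triangle ha (Set.eq_univ_of_forall fun x => ?_) hU
    by_contra hx
    simpa [hV] using h.mem_closure_right x hx (by simp [hV])
  have hVne := hnonempty h hUa
  have hUne := hnonempty h.symm hVa
  obtain ⟨σ, hσ, hσa, hκ0, hκ1⟩ := exists_apex_rotation (div_pos ha hb) ((div_lt_one hb).mpr hab)
  have hσmem : σ ∈ rotationSymmetries U V b := mem_rotationSymmetries h hL hb hUa hUb hVa hVb hσ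
    (by rw [hσa, div_mul_cancel₀ _ hb.ne'])
  have hωmem : sixthRoot ∈ rotationSymmetries U V b :=
    mem_rotationSymmetries h hL hb hUb hUb hVb hVb norm_sixthRoot
      (by rw [norm_one_sub_sixthRoot, one_mul])
  set s : Set ℂ := {sixthRoot, σ} with hs
  have hsH : s ⊆ rotationSymmetries U V b := by
    rintro x (rfl | rfl)
    exacts [hωmem, hσmem]
  have hKc : (Subfield.closure s : Set ℂ).Countable := by
    rw [← Cardinal.le_aleph0_iff_set_countable]
    refine (Subfield.cardinalMk_closure_le_max s).trans (max_le ?_ le_rfl)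
    exact Cardinal.le_aleph0_iff_set_countable.mpr (Set.toFinite s).countable
  obtain ⟨A, hAU, hAV, hA⟩ := exists_isGeneric (b := b) h hL hUne hVne hKc
  obtain ⟨w, hw⟩ := changes_nonempty h hL hb hUb hVb hAU hAV
  have hwb : ‖w‖ = b := norm_eq_of_mem_closure_circ hw.1
  obtain ⟨c, hc⟩ := hUne
  obtain ⟨r, hr, hball⟩ := Metric.isOpen_iff.mp h.isOpen_left c hc
  obtain ⟨n, hn⟩ := exists_pow_lt_of_lt_one (div_pos hr hb) hκ1
  rw [lt_div_iff₀ hb] at hn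
  set v := (sixthRoot - σ) ^ n * w with hv
  have hv0 : v ≠ 0 := by
    have : w ≠ 0 := by
      rintro rfl
      rw [norm_zero] at hwb
      exact hb.ne hwb
    exact mul_ne_zero (pow_ne_zero n hκ0) this
  have hvr : ‖v‖ < r := by rwa [hv, norm_mul, norm_pow, hwb]
  obtain ⟨i, j, hij⟩ := exists_eisenstein_near ((c - A) / v)
  have hωs : sixthRoot ∈ Subring.closure s := Subring.subset_closure (by simp [hs])
  have hσs : σ ∈ Subring.closure s := Subring.subset_closure (by simp [hs])
  have hm : (i + j * sixthRoot) * (sixthRoot - σ) ^ n ∈ Subring.closure s :=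
    mul_mem (add_mem (intCast_mem _ i) (mul_mem (intCast_mem _ j) hωs))
      (pow_mem (sub_mem hωs hσs) n)
  refine (hA.notMem_of_mem_closure h hL hb hsH hωmem hAU hAV hw hm).1 (hball ?_)
  rw [Metric.mem_ball, dist_comm, dist_eq_norm]
  have heq : c - (A + (i + j * sixthRoot) * (sixthRoot - σ) ^ n * w) =
      ((c - A) / v - (i + j * sixthRoot)) * v := by
    rw [sub_mul, div_mul_cancel₀ _ hv0, hv]; ring
  rw [heq, norm_mul]
  nlinarith [norm_nonneg v]

/-- The isometric identification of the complex plane with the Euclidean plane. -/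
def complexPlane : ℂ ≃ₗᵢ[ℝ] EuclideanSpace ℝ (Fin 2) := Complex.orthonormalBasisOneI.repr

lemma mem_frontier_of_notMem_interior {X : Type*} [TopologicalSpace X] {B : Set X} {x : X}
    (hB : x ∉ interior B) (hW : x ∉ interior Bᶜ) : x ∈ frontier B := by
  rw [interior_compl, Set.mem_compl_iff, not_not] at hW
  exact ⟨hW, hB⟩

lemma openColoring_preimage_interior {B : Set (EuclideanSpace ℝ (Fin 2))}
    (hB : B ⊆ closure (interior B)) (hW : Bᶜ ⊆ closure (interior Bᶜ)) :
    OpenColoring (complexPlane ⁻¹' interior B) (complexPlane ⁻¹' interior Bᶜ) where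
  isOpen_left := isOpen_interior.preimage complexPlane.continuous
  isOpen_right := isOpen_interior.preimage complexPlane.continuous
  disjoint := (disjoint_compl_right.mono interior_subset interior_subset).preimage _
  mem_closure_left x hx hx' := by
    have hf := mem_frontier_of_notMem_interior hx hx'
    have := closure_minimal hB isClosed_closure (frontier_subset_closure hf)
    exact (complexPlane.toHomeomorph.preimage_closure _).subset this
  mem_closure_right x hx hx' := by
    have hf := mem_frontier_of_notMem_interior hx hx'
    rw [← frontier_compl] at hf
    have := closure_minimal hW isClosed_closure (frontier_subset_closure hf)
    exact (complexPlane.toHomeomorph.preimage_closure _).subset this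

lemma IsSeg.exists_normal {s : Set (EuclideanSpace ℝ (Fin 2))} (hs : IsSeg s) :
    ∃ p : ℂ × ℝ, p.1 ≠ 0 ∧ ∀ x, complexPlane x ∈ s → cdot p.1 x = p.2 := by
  obtain ⟨-, -, -, l, ⟨⟨q, hq⟩, hl⟩, hsl⟩ := hs
  obtain ⟨d, hd0, hd⟩ := finrank_eq_one_iff'.mp hl
  set v := complexPlane.symm d with hv
  have hv0 : v ≠ 0 := by simpa [hv] using hd0
  refine ⟨(Complex.I * v, cdot (Complex.I * v) (complexPlane.symm q)),
    mul_ne_zero Complex.I_ne_zero hv0, fun x hx => ?_⟩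
  obtain ⟨r, hr⟩ := hd ⟨_, l.vsub_mem_direction (hsl hx) hq⟩
  have hr' : x = complexPlane.symm q + r • v := by
    have : r • (d : EuclideanSpace ℝ (Fin 2)) = complexPlane x - q := congrArg Subtype.val hr
    rw [hv, ← map_smul, this, map_sub, complexPlane.symm_apply_apply]; ring
  rw [hr']
  simp [cdot]; ring

lemma IsPolygonal.exists_locallyInLines {B : Set (EuclideanSpace ℝ (Fin 2))}
    {S : Set (Set (EuclideanSpace ℝ (Fin 2)))} (h : IsPolygonal B S) :
    ∃ L, LocallyInLines (complexPlane ⁻¹' interior B) (complexPlane ⁻¹' interior Bᶜ) L := by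
  choose! f hf0 hf using fun s hs => (h.seg s hs).exists_normal
  refine ⟨f '' S, ?_, Set.Countable.image ?_ f, fun R => ?_⟩
  · rintro _ ⟨s, hs, rfl⟩
    exact hf0 s hs
  · refine (Set.countable_iUnion fun n : ℕ =>
      (h.loc_finite _ (Metric.isBounded_ball (x := 0) (r := n))).countable).mono fun s hs => ?_
    obtain ⟨x, hx⟩ := (h.seg s hs).2.2.1.nonempty
    obtain ⟨n, hn⟩ := exists_nat_gt ‖x‖
    exact Set.mem_iUnion.mpr ⟨n, hs, x, hx, by simpa using hn⟩
  · refine ⟨f '' {s ∈ S | (s ∩ Metric.closedBall 0 R).Nonempty},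
      Set.image_mono (Set.sep_subset _ _),
      (h.loc_finite _ Metric.isBounded_closedBall).image f, fun x hxR hx hx' => ?_⟩
    have hxf := mem_frontier_of_notMem_interior hx hx'
    rw [h.boundary] at hxf
    obtain ⟨s, hs, hxs⟩ := hxf
    exact ⟨f s, ⟨s, ⟨hs, _, hxs, by simpa using hxR⟩, rfl⟩, hf s hs x hxs⟩

theorem stmt12 (B : Set (EuclideanSpace ℝ (Fin 2))) (S : Set (Set (EuclideanSpace ℝ (Fin 2))))
    (hpoly : IsPolygonal B S) (a b : ℝ) (ha : 0 < a) (hb : 0 < b) (hab : a ≠ b) :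
    ∃ x ∈ ({a, b} : Set ℝ), ∃ X Y Z : EuclideanSpace ℝ (Fin 2),
      X ∉ frontier B ∧ Y ∉ frontier B ∧ Z ∉ frontier B ∧
      ((X ∈ B ∧ Y ∈ B ∧ Z ∈ B) ∨ (X ∉ B ∧ Y ∉ B ∧ Z ∉ B)) ∧
      dist X Y = x ∧ dist Y Z = x ∧ dist Z X = x := by
  by_contra! hno
  have hN : ∀ d ∈ ({a, b} : Set ℝ), NoTriangle (complexPlane ⁻¹' interior B) d ∧
      NoTriangle (complexPlane ⁻¹' interior Bᶜ) d := by
    refine fun d hd => ⟨fun X Y Z hXY hYZ hZX hX hY hZ => ?_,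
      fun X Y Z hXY hYZ hZX hX hY hZ => ?_⟩ <;>
    rw [← dist_eq_norm, ← complexPlane.dist_map] at hXY hYZ hZX
    · have hfr : ∀ {x}, x ∈ interior B → x ∉ frontier B := fun hx hx' => hx'.2 hx
      exact hno d hd _ _ _ (hfr hX) (hfr hY) (hfr hZ)
        (.inl ⟨interior_subset hX, interior_subset hY, interior_subset hZ⟩) hXY hYZ hZX
    · have hfr : ∀ {x}, x ∈ interior Bᶜ → x ∉ frontier B := fun hx hx' =>
        (frontier_compl B ▸ hx').2 hx
      exact hno d hd _ _ _ (hfr hX) (hfr hY) (hfr hZ)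
        (.inr ⟨interior_subset hX, interior_subset hY, interior_subset hZ⟩) hXY hYZ hZX
  obtain ⟨hUa, hVa⟩ := hN a (by simp)
  obtain ⟨hUb, hVb⟩ := hN b (by simp)
  have hcol := openColoring_preimage_interior hpoly.black_sub hpoly.white_sub
  obtain ⟨L, hL⟩ := hpoly.exists_locallyInLines
  rcases hab.lt_or_gt with hlt | hlt
  · exact false_of_noTriangle hcol hL ha hlt hUa hUb hVa hVb
  · exact false_of_noTriangle hcol hL hb hlt hUb hUa hVb hVa

end
end

section
/- Let (B,W) be a polygonal coloring of the plane with boundary ∂ satisfying condition (C3). Let A be a feasible point lying on the boundary segment s, and let n be a unit vector orthogonal to the direction of the line containing s. Then A + n ∉ ∂ and A − n ∉ ∂. -/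
open scoped RealInnerProductSpace

noncomputable section

open Filter Topology

/-- The real inner product of two complex numbers, in coordinates. -/
def dotC (a b : ℂ) : ℝ := a.re * b.re + a.im * b.im

/-- Near `P`, the open half-plane `0 < dotC ν (q - P)` lies in `U`, and the opposite one in `V`. -/
def IsEdge (U V : Set ℂ) (P ν : ℂ) : Prop :=
  ν ≠ 0 ∧ ∀ᶠ q in 𝓝 P, (0 < dotC ν (q - P) → q ∈ U) ∧ (dotC ν (q - P) < 0 → q ∈ V)

/-- A curve leaving `P` with velocity `w` enters `U`. -/
def Toward (U V : Set ℂ) (P w : ℂ) : Prop :=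
  P ∈ U ∨ ∃ ν, IsEdge U V P ν ∧ 0 < dotC ν w

/-- Two disjoint open color classes without monochromatic unit triangles such that every point of
the unit circle is colored or lies on a straight edge between the two classes. -/
structure CircleColoring (U V : Set ℂ) : Prop where
  isOpen_left : IsOpen U
  isOpen_right : IsOpen V
  disjoint : Disjoint U V
  left_free : ∀ X ∈ U, ∀ Y ∈ U, ∀ Z ∈ U, dist X Y = 1 → dist Y Z = 1 → dist Z X = 1 → False
  right_free : ∀ X ∈ V, ∀ Y ∈ V, ∀ Z ∈ V, dist X Y = 1 → dist Y Z = 1 → dist Z X = 1 → False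
  local_edge : ∀ P : ℂ, ‖P‖ = 1 → P ∈ U ∨ P ∈ V ∨ ∃ ν, IsEdge U V P ν

lemma IsEdge.symm {U V : Set ℂ} {P ν : ℂ} (h : IsEdge U V P ν) : IsEdge V U P (-ν) := by
  refine ⟨neg_ne_zero.mpr h.1, h.2.mono fun q hq => ?_⟩
  have e : dotC (-ν) (q - P) = -dotC ν (q - P) := by simp [dotC]; ring
  rw [e]
  exact ⟨fun h1 => hq.2 (by linarith), fun h1 => hq.1 (by linarith)⟩

lemma CircleColoring.symm {U V : Set ℂ} (h : CircleColoring U V) : CircleColoring V U where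
  isOpen_left := h.isOpen_right
  isOpen_right := h.isOpen_left
  disjoint := h.disjoint.symm
  left_free := h.right_free
  right_free := h.left_free
  local_edge P hP := by
    rcases h.local_edge P hP with h1 | h1 | ⟨ν, h1⟩
    · exact Or.inr (Or.inl h1)
    · exact Or.inl h1
    · exact Or.inr (Or.inr ⟨-ν, h1.symm⟩)

lemma eventually_pos_of_hasDerivAt {f : ℝ → ℝ} {f' a : ℝ} (hf : HasDerivAt f f' a) (h0 : f a = 0)
    (hpos : 0 < f') : ∀ᶠ t in 𝓝[>] a, 0 < f t := by
  have h1 := (hasDerivAt_iff_tendsto_slope.mp hf).eventually (lt_mem_nhds hpos)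
  have h2 : ∀ᶠ t in 𝓝[>] a, 0 < slope f a t :=
    h1.filter_mono (nhdsWithin_mono _ fun x hx => ne_of_gt hx)
  filter_upwards [h2, self_mem_nhdsWithin] with t ht hta
  have hta' : 0 < t - a := sub_pos.mpr hta
  rw [slope_def_field, h0, sub_zero] at ht
  exact (div_pos_iff_of_pos_right hta').mp ht

lemma Toward.eventually_mem {U V : Set ℂ} {γ : ℝ → ℂ} {w : ℂ} {a : ℝ} (hU : IsOpen U)
    (h : Toward U V (γ a) w) (hγ : HasDerivAt γ w a) : ∀ᶠ t in 𝓝[>] a, γ t ∈ U := by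
  have hc : Tendsto γ (𝓝[>] a) (𝓝 (γ a)) := hγ.continuousAt.tendsto.mono_left nhdsWithin_le_nhds
  rcases h with h | ⟨ν, hν, hw⟩
  · exact hc.eventually (hU.mem_nhds h)
  · have hd : HasDerivAt (fun t => dotC ν (γ t - γ a)) (dotC ν w) a := by
      have h1 : HasDerivAt (fun t => (γ t - γ a).re) w.re a :=
        Complex.reCLM.hasFDerivAt.comp_hasDerivAt a (hγ.sub_const (γ a))
      have h2 : HasDerivAt (fun t => (γ t - γ a).im) w.im a :=
        Complex.imCLM.hasFDerivAt.comp_hasDerivAt a (hγ.sub_const (γ a))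
      exact (h1.const_mul ν.re).add (h2.const_mul ν.im)
    have hp := eventually_pos_of_hasDerivAt hd (by simp [dotC]) hw
    filter_upwards [hp, hc.eventually hν.2] with t h1 h2 using h2.1 h1

/-- The rotation by `ω t` applied to `R`, as a curve in `t`. -/
def spin (R : ℂ) (ω t : ℝ) : ℂ := R * Complex.exp (((ω * t : ℝ) : ℂ) * Complex.I)

@[simp] lemma spin_zero (R : ℂ) (ω : ℝ) : spin R ω 0 = R := by simp [spin]

lemma hasDerivAt_spin (R : ℂ) (ω a : ℝ) :
    HasDerivAt (spin R ω) (ω * (Complex.I * spin R ω a)) a := by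
  have h1 : HasDerivAt (fun t : ℝ => (((ω * t : ℝ) : ℂ) * Complex.I)) (ω * Complex.I) a := by
    have := ((hasDerivAt_id a).const_mul ω).ofReal_comp.mul_const Complex.I
    simpa using this
  refine (h1.cexp.const_mul R).congr_deriv ?_
  rw [spin]
  ring

lemma hasDerivAt_spin_zero (R : ℂ) (ω : ℝ) : HasDerivAt (spin R ω) (ω * (Complex.I * R)) 0 := by
  simpa using hasDerivAt_spin R ω 0

lemma norm_spin (R : ℂ) (ω t : ℝ) : ‖spin R ω t‖ = ‖R‖ := by
  rw [spin, norm_mul, Complex.norm_exp_ofReal_mul_I, mul_one]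

lemma norm_eq_one_of_sq {a b : ℝ} (h : a ^ 2 + b ^ 2 = 1) : ‖(⟨a, b⟩ : ℂ)‖ = 1 := by
  rw [Complex.norm_eq_sqrt_sq_add_sq]; simp [h]

/-- The complex number `(1 + s i) / 2`; a primitive sixth root of unity when `s ^ 2 = 3`. -/
def sixth (s : ℝ) : ℂ := ⟨1 / 2, s / 2⟩

lemma norm_sixth {s : ℝ} (hs : s ^ 2 = 3) : ‖sixth s‖ = 1 :=
  norm_eq_one_of_sq (by nlinarith)

lemma norm_one_sub_sixth {s : ℝ} (hs : s ^ 2 = 3) : ‖1 - sixth s‖ = 1 := by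
  have : 1 - sixth s = ⟨1 / 2, -(s / 2)⟩ := by
    apply Complex.ext <;> simp [sixth]; norm_num
  rw [this]
  exact norm_eq_one_of_sq (by nlinarith)

lemma CircleColoring.not_eventually {U V : Set ℂ} (h : CircleColoring U V) {s : ℝ} (hs : s ^ 2 = 3)
    {R : ℂ} (hR : ‖R‖ = 1) (X : ℝ → ℂ) (ω : ℝ) (h0 : ∀ᶠ t in 𝓝[>] (0 : ℝ), X t ∈ U)
    (h1 : ∀ᶠ t in 𝓝[>] (0 : ℝ), X t + spin R ω t ∈ U)
    (h2 : ∀ᶠ t in 𝓝[>] (0 : ℝ), X t + spin (sixth s * R) ω t ∈ U) : False := by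
  obtain ⟨t, h0, h1, h2⟩ := (h0.and (h1.and h2)).exists
  refine h.left_free _ h0 _ h1 _ h2 ?_ ?_ ?_
  · rw [dist_eq_norm, sub_add_cancel_left, norm_neg, norm_spin, hR]
  · have : X t + spin R ω t - (X t + spin (sixth s * R) ω t) = spin ((1 - sixth s) * R) ω t := by
      simp only [spin]; ring
    rw [dist_eq_norm, this, norm_spin, norm_mul, norm_one_sub_sixth hs, hR, one_mul]
  · rw [dist_eq_norm, add_sub_cancel_left, norm_spin, norm_mul, norm_sixth hs, hR, one_mul]

lemma CircleColoring.not_toward {U V : Set ℂ} (h : CircleColoring U V) {s : ℝ} (hs : s ^ 2 = 3)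
    {R : ℂ} (hR : ‖R‖ = 1) (v : ℂ) (ω : ℝ) (h0 : Toward U V 0 v)
    (h1 : Toward U V R (v + ω * (Complex.I * R)))
    (h2 : Toward U V (sixth s * R) (v + ω * (Complex.I * (sixth s * R)))) : False := by
  have hX : HasDerivAt (fun t : ℝ => (t : ℂ) * v) v 0 := by
    have := (hasDerivAt_id (0 : ℝ)).ofReal_comp.mul_const v
    simpa using this
  refine h.not_eventually hs hR (fun t => (t : ℂ) * v) ω ?_ ?_ ?_
  · exact Toward.eventually_mem h.isOpen_left (by simpa using h0) hX
  · exact Toward.eventually_mem h.isOpen_left (by simpa using h1) (hX.add (hasDerivAt_spin_zero R ω))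
  · exact Toward.eventually_mem h.isOpen_left (by simpa using h2)
      (hX.add (hasDerivAt_spin_zero (sixth s * R) ω))

/-- A Farkas-type alternative for three linear functionals on `ℝ³`, the first of which is a
coordinate. -/
lemma exists_nonneg_combination {p q k p' q' k' : ℝ} (hpk : p ≠ 0 ∨ k ≠ 0)
    (h : ∀ x y w : ℝ, 0 < y → 0 < p * x + q * y + k * w → p' * x + q' * y + k' * w ≤ 0) :
    ∃ α β : ℝ, 0 ≤ α ∧ 0 ≤ β ∧ p' = -β * p ∧ q' = -α - β * q ∧ k' = -β * k := by
  have hD : 0 < p ^ 2 + k ^ 2 := by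
    rcases hpk with h | h
    · have := sq_pos_of_ne_zero h; nlinarith [sq_nonneg k]
    · have := sq_pos_of_ne_zero h; nlinarith [sq_nonneg p]
  set D := p ^ 2 + k ^ 2 with hDdef
  set β := -(p' * p + k' * k) / D with hβ
  have hβD : β * D = -(p' * p + k' * k) := by rw [hβ]; field_simp
  set c := (p' * k - k' * p) / D with hc
  have hcD : c * D = p' * k - k' * p := by rw [hc]; field_simp
  have key : ∀ m y T : ℝ, 0 < m → 0 < y → -β * m + (q' + β * q) * y + c * T ≤ 0 := by
    intro m y T hm hy
    have h1 := h ((p * (m - q * y) + k * T) / D) y ((k * (m - q * y) - p * T) / D) hy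
      (by
        have : p * ((p * (m - q * y) + k * T) / D) + q * y + k * ((k * (m - q * y) - p * T) / D)
            = m := by
          field_simp; rw [hDdef]; ring
        rw [this]; exact hm)
    have : p' * ((p * (m - q * y) + k * T) / D) + q' * y + k' * ((k * (m - q * y) - p * T) / D)
        = -β * m + (q' + β * q) * y + c * T := by
      rw [hβ, hc]; field_simp; ring
    linarith
  have hc0 : c = 0 := by
    by_contra hne
    have h1 := key 1 1 ((|β| + |q' + β * q| + 1) / c) one_pos one_pos
    rw [mul_div_cancel₀ _ hne] at h1
    linarith [le_abs_self β, neg_abs_le (q' + β * q)]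
  rw [hc0] at key hcD
  have hβ0 : 0 ≤ β := by
    by_contra! hlt
    have h1 := key ((|q' + β * q| + 1) / (-β)) 1 0 (by
      apply div_pos; positivity; linarith) one_pos
    rw [mul_div_cancel₀ _ (neg_pos.mpr hlt).ne'] at h1
    linarith [neg_abs_le (q' + β * q)]
  have hα0 : 0 ≤ -(q' + β * q) := by
    by_contra! hlt
    have hlt' : 0 < q' + β * q := by linarith
    have h1 := key 1 ((β + 1) / (q' + β * q)) 0 one_pos (by positivity)
    rw [mul_div_cancel₀ _ hlt'.ne'] at h1
    linarith
  refine ⟨-(q' + β * q), β, hα0, hβ0, ?_, by ring, ?_⟩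
  · apply mul_right_cancel₀ hD.ne'
    linear_combination k * hcD * (-1) + p * hβD
  · apply mul_right_cancel₀ hD.ne'
    linear_combination p * hcD + k * hβD

lemma toward_of_im_pos {U V : Set ℂ} (h0 : IsEdge U V 0 Complex.I) {v : ℂ} (hv : 0 < v.im) :
    Toward U V 0 v :=
  Or.inr ⟨_, h0, by simpa [dotC] using hv⟩

lemma toward_of_im_neg {U V : Set ℂ} (h0 : IsEdge U V 0 Complex.I) {v : ℂ} (hv : v.im < 0) :
    Toward V U 0 v :=
  Or.inr ⟨_, h0.symm, by simpa [dotC] using hv⟩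

lemma exists_motion {p q k : ℝ} (hpk : p ≠ 0 ∨ k ≠ 0) (y m : ℝ) :
    ∃ x w : ℝ, p * x + q * y + k * w = m := by
  rcases hpk with h | h
  · exact ⟨(m - q * y) / p, 0, by field_simp; ring⟩
  · exact ⟨0, (m - q * y) / k, by field_simp; ring⟩

lemma dotC_motion (ν R : ℂ) (x y w : ℝ) :
    dotC ν ((⟨x, y⟩ : ℂ) + w * (Complex.I * R)) =
      ν.re * x + ν.im * y + dotC ν (Complex.I * R) * w := by
  simp [dotC]; ring

/-- The boundary spreads along the unit circle by rotations of sixty degrees. -/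
lemma CircleColoring.exists_edge {U V : Set ℂ} (h : CircleColoring U V)
    (h0 : IsEdge U V 0 Complex.I) {s : ℝ} (hs : s ^ 2 = 3) {R ν : ℂ} (hR : ‖R‖ = 1)
    (hν : IsEdge U V R ν) (hne : ν.re ≠ 0 ∨ dotC ν (Complex.I * R) ≠ 0) :
    ∃ ν', IsEdge U V (sixth s * R) ν' := by
  rcases h.local_edge (sixth s * R) (by rw [norm_mul, norm_sixth hs, hR, one_mul]) with
    h1 | h1 | h1
  · obtain ⟨x, w, hxw⟩ := exists_motion (q := ν.im) hne 1 1
    exact (h.not_toward hs hR ⟨x, 1⟩ w (toward_of_im_pos h0 (by simp))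
      (Or.inr ⟨ν, hν, by rw [dotC_motion, hxw]; exact one_pos⟩) (Or.inl h1)).elim
  · obtain ⟨x, w, hxw⟩ := exists_motion (q := ν.im) hne (-1) (-1)
    have e : dotC (-ν) ((⟨x, -1⟩ : ℂ) + w * (Complex.I * R)) = 1 := by
      have := dotC_motion ν R x (-1) w
      rw [hxw] at this
      simp [dotC] at this ⊢
      linarith
    exact (h.symm.not_toward hs hR ⟨x, -1⟩ w
      (toward_of_im_neg h0 (by simp)) (Or.inr ⟨-ν, hν.symm, by rw [e]; exact one_pos⟩)
      (Or.inl h1)).elim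
  · exact h1

lemma CircleColoring.exists_nonneg_combination {U V : Set ℂ} (h : CircleColoring U V)
    (h0 : IsEdge U V 0 Complex.I) {s : ℝ} (hs : s ^ 2 = 3) {R ν ν' : ℂ} (hR : ‖R‖ = 1)
    (hν : IsEdge U V R ν) (hne : ν.re ≠ 0 ∨ dotC ν (Complex.I * R) ≠ 0)
    (hν' : IsEdge U V (sixth s * R) ν') :
    ∃ α β : ℝ, 0 ≤ α ∧ 0 ≤ β ∧ ν'.re = -β * ν.re ∧ ν'.im = -α - β * ν.im ∧
      dotC ν' (Complex.I * (sixth s * R)) = -β * dotC ν (Complex.I * R) := by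
  refine _root_.exists_nonneg_combination hne fun x y w hy hpos => ?_
  by_contra! hlt
  exact h.not_toward hs hR ⟨x, y⟩ w (toward_of_im_pos h0 hy)
    (Or.inr ⟨ν, hν, by rwa [dotC_motion]⟩) (Or.inr ⟨ν', hν', by rwa [dotC_motion]⟩)

lemma exists_sq_eq_three (a : ℝ) : ∃ s : ℝ, s ^ 2 = 3 ∧ 0 ≤ s * a := by
  have h3 : Real.sqrt 3 ^ 2 = 3 := Real.sq_sqrt (by norm_num)
  rcases le_total 0 a with h | h
  · exact ⟨√3, h3, mul_nonneg (Real.sqrt_nonneg _) h⟩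
  · exact ⟨-√3, by rw [neg_sq, h3], by nlinarith [Real.sqrt_nonneg 3]⟩

lemma IsEdge.re_ne_or_im_ne {U V : Set ℂ} {P ν : ℂ} (h : IsEdge U V P ν) :
    ν.re ≠ 0 ∨ ν.im ≠ 0 := by
  by_contra! hc
  exact h.1 (Complex.ext hc.1 hc.2)

lemma IsEdge.nondegenerate {U V : Set ℂ} {P ν : ℂ} (h : IsEdge U V P ν) (hP : P.re ≠ 0) :
    ν.re ≠ 0 ∨ dotC ν (Complex.I * P) ≠ 0 := by
  by_contra! hc
  have h2 : ν.im * P.re = 0 := by simpa [dotC, hc.1] using hc.2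
  exact (h.re_ne_or_im_ne.resolve_left (not_not.mpr hc.1)) ((mul_eq_zero.mp h2).resolve_right hP)

/-- An edge through the top of the unit circle is horizontal. -/
lemma CircleColoring.edge_I_re_eq_zero {U V : Set ℂ} (h : CircleColoring U V)
    (h0 : IsEdge U V 0 Complex.I) {ν : ℂ} (hν : IsEdge U V Complex.I ν) : ν.re = 0 := by
  by_contra hne
  obtain ⟨s, hs, hsν⟩ := exists_sq_eq_three ν.re
  have hs0 : s ≠ 0 := by rintro rfl; norm_num at hs
  have hsν' : 0 < s * ν.re := lt_of_le_of_ne hsν (mul_ne_zero hs0 hne).symm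
  obtain ⟨p, hp⟩ := h.exists_edge h0 hs (by simp) hν (Or.inl hne)
  obtain ⟨α, β, hα, hβ, h1, h2, h3⟩ :=
    h.exists_nonneg_combination h0 hs (by simp) hν (Or.inl hne) hp
  have hR1 : ‖sixth s * Complex.I‖ = 1 := by rw [norm_mul, norm_sixth hs]; simp
  have hnd := hp.nondegenerate (by simpa [sixth] using hs0)
  obtain ⟨r, hr⟩ := h.exists_edge h0 hs hR1 hp hnd
  obtain ⟨α', β', hα', hβ', h1', h2', h3'⟩ := h.exists_nonneg_combination h0 hs hR1 hp hnd hr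
  simp [dotC, sixth] at h3 h3'
  have e1 : p.re = s * p.im := by linarith
  have e2 : s * α' = 2 * (β' * p.re) := by
    rw [h1', h2'] at h3'
    linear_combination 2 * h3' + β' * p.re / 2 * hs
  have e3 : 3 * α' = -(2 * (β' * β * (s * ν.re))) := by
    rw [h1] at e2
    linear_combination s * e2 - α' * hs
  have hβ0 : β ≠ 0 := by
    rintro rfl
    have hre : p.re = 0 := by simpa using h1
    have him : p.im = 0 := by simpa [hre, hs0] using e1.symm
    exact hp.1 (Complex.ext hre him)
  have hprod : 0 ≤ β' * β * (s * ν.re) := by positivity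
  have hα0 : α' = 0 := by linarith
  have hβ'0 : β' = 0 := by
    have : β' * β * (s * ν.re) = 0 := by linarith
    simpa [hβ0, hsν'.ne', hs0, hne] using this
  exact hr.1 (Complex.ext (by simp [h1', hβ'0]) (by simp [h2', hα0, hβ'0]))

/-- If the top of the unit circle lies on the boundary, the colors there are reversed with respect
to those at the center. -/
lemma CircleColoring.edge_I_im_neg {U V : Set ℂ} (h : CircleColoring U V)
    (h0 : IsEdge U V 0 Complex.I) {ν : ℂ} (hν : IsEdge U V Complex.I ν) : ν.im < 0 := by
  have hre := h.edge_I_re_eq_zero h0 hν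
  by_contra! hle
  have him : 0 < ν.im := lt_of_le_of_ne hle
    (hν.re_ne_or_im_ne.resolve_left (not_not.mpr hre)).symm
  obtain ⟨s, hs, -⟩ := exists_sq_eq_three 0
  have hs0 : s ≠ 0 := by rintro rfl; norm_num at hs
  have hU : ∀ x w : ℝ, Toward U V Complex.I ((⟨x, 1⟩ : ℂ) + w * (Complex.I * Complex.I)) :=
    fun x w => Or.inr ⟨ν, hν, by simpa [dotC, hre] using him⟩
  rcases h.local_edge (sixth s * Complex.I) (by rw [norm_mul, norm_sixth hs]; simp) with
    h1 | h1 | ⟨p, hp⟩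
  · exact h.not_toward hs (by simp) ⟨0, 1⟩ 0 (toward_of_im_pos h0 (by simp)) (hU 0 0) (Or.inl h1)
  · exact h.symm.not_toward hs (by simp) ⟨0, -1⟩ 0 (toward_of_im_neg h0 (by simp))
      (Or.inr ⟨-ν, hν.symm, by simpa [dotC, hre] using him⟩) (Or.inl h1)
  · obtain ⟨x, w, hxw⟩ := exists_motion (q := p.im)
      (hp.nondegenerate (by simpa [sixth] using hs0)) 1 1
    exact h.not_toward hs (by simp) ⟨x, 1⟩ w (toward_of_im_pos h0 (by simp)) (hU x w)
      (Or.inr ⟨p, hp, by rw [dotC_motion, hxw]; exact one_pos⟩)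

lemma CircleColoring.sixth_mul_I_mem {U V : Set ℂ} (h : CircleColoring U V)
    (h0 : IsEdge U V 0 Complex.I) {ν : ℂ} (hν : IsEdge U V Complex.I ν) {s : ℝ} (hs : s ^ 2 = 3) :
    sixth s * Complex.I ∈ V := by
  have hre := h.edge_I_re_eq_zero h0 hν
  have him := h.edge_I_im_neg h0 hν
  have hs0 : s ≠ 0 := by rintro rfl; norm_num at hs
  -- The center slides along its edge while the triangle turns; the second-order drop of the top
  -- vertex leaves room to lift the whole triangle.
  have key : ∀ x w : ℝ, w ^ 2 = 1 →
      Toward U V (sixth s * Complex.I) (x + w * (Complex.I * (sixth s * Complex.I))) → False := by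
    intro x w hw hT
    have hX : HasDerivAt (fun t : ℝ => (t : ℂ) * x + ((t ^ 2 / 10 : ℝ) : ℂ) * Complex.I) x 0 := by
      have h1 := (hasDerivAt_id (0 : ℝ)).ofReal_comp.mul_const (x : ℂ)
      have h2 := (((hasDerivAt_id (0 : ℝ)).pow 2).div_const 10).ofReal_comp.mul_const Complex.I
      refine (h1.add h2).congr_deriv ?_
      simp
    have hXim : ∀ t : ℝ, ((t : ℂ) * x + ((t ^ 2 / 10 : ℝ) : ℂ) * Complex.I).im = t ^ 2 / 10 :=
      fun t => by
        simp only [Complex.add_im, Complex.im_ofReal_mul, Complex.ofReal_im, mul_zero,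
          Complex.I_im, zero_add, mul_one]
    have hY : HasDerivAt _ _ (0 : ℝ) := hX.add (hasDerivAt_spin_zero Complex.I w)
    refine h.not_eventually hs (by simp : ‖Complex.I‖ = 1)
      (fun t : ℝ => (t : ℂ) * x + ((t ^ 2 / 10 : ℝ) : ℂ) * Complex.I) w ?_ ?_ ?_
    · have hc := hX.continuousAt.tendsto.mono_left (nhdsWithin_le_nhds (s := Set.Ioi 0))
      simp only [Complex.ofReal_zero, zero_mul, ne_eq, OfNat.ofNat_ne_zero, not_false_eq_true,
        zero_pow, zero_div, add_zero] at hc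
      filter_upwards [hc.eventually h0.2, self_mem_nhdsWithin] with t h1 ht
      refine h1.1 ?_
      have ht' : 0 < t := ht
      simp only [dotC, sub_zero, hXim, Complex.I_re, Complex.I_im, zero_mul, zero_add, one_mul]
      positivity
    · have hc := hY.continuousAt.tendsto.mono_left (nhdsWithin_le_nhds (s := Set.Ioi 0))
      simp only [Pi.add_apply, spin_zero, Complex.ofReal_zero, zero_mul, ne_eq,
        OfNat.ofNat_ne_zero, not_false_eq_true, zero_pow, zero_div, add_zero, zero_add] at hc
      filter_upwards [hc.eventually hν.2, Ioo_mem_nhdsGT (one_pos : (0 : ℝ) < 1)] with t h1 ht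
      refine h1.1 ?_
      have hwt : (w * t) ^ 2 = t ^ 2 := by rw [mul_pow, hw, one_mul]
      have hw1 : |w| = 1 := by exact (pow_eq_one_iff_of_nonneg (abs_nonneg w) two_ne_zero).mp (by rwa [sq_abs])
      have hwt1 : |w * t| = t := by rw [abs_mul, hw1, one_mul, abs_of_pos ht.1]
      have hcos := (abs_le.mp (Real.cos_bound (hwt1.trans_le ht.2.le))).2
      rw [hwt1, hwt] at hcos
      have hspin : (spin Complex.I w t).im = Real.cos (w * t) := by
        rw [spin, Complex.I_mul_im, Complex.exp_ofReal_mul_I_re]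
      simp only [dotC, hre, zero_mul, zero_add]
      refine mul_pos_of_neg_of_neg him ?_
      simp only [Pi.add_apply, Complex.sub_im, Complex.add_im, hXim, hspin, Complex.I_im]
      have ht4 : t ^ 4 ≤ t ^ 2 := pow_le_pow_of_le_one ht.1.le ht.2.le (by norm_num)
      have ht2 : 0 < t ^ 2 := by have := ht.1; positivity
      linarith
    · exact Toward.eventually_mem h.isOpen_left (by simpa using hT)
        (hX.add (hasDerivAt_spin_zero (sixth s * Complex.I) w))
  rcases h.local_edge (sixth s * Complex.I) (by rw [norm_mul, norm_sixth hs]; simp) with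
    h1 | h1 | ⟨p, hp⟩
  · exact (key 0 1 (by norm_num) (Or.inl h1)).elim
  · exact h1
  · exfalso
    have hd : ∀ x w : ℝ, dotC p (x + w * (Complex.I * (sixth s * Complex.I))) =
        p.re * x + dotC p (Complex.I * (sixth s * Complex.I)) * w := by
      intro x w; simp [dotC]; ring
    rcases eq_or_ne p.re 0 with hp0 | hp0
    · have hk := (hp.nondegenerate (by simpa [sixth] using hs0)).resolve_left (not_not.mpr hp0)
      rcases lt_or_gt_of_ne hk with hk | hk
      · exact key 0 (-1) (by norm_num) (Or.inr ⟨p, hp, by rw [hd, hp0]; linarith⟩)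
      · exact key 0 1 (by norm_num) (Or.inr ⟨p, hp, by rw [hd, hp0]; linarith⟩)
    · refine key ((1 - dotC p (Complex.I * (sixth s * Complex.I))) / p.re) 1 (by norm_num)
        (Or.inr ⟨p, hp, ?_⟩)
      rw [hd, mul_div_cancel₀ _ hp0]
      linarith

/-- On the arc of the unit circle within thirty degrees of the right end, every edge is crossed
counterclockwise from `V` to `U`. -/
lemma CircleColoring.dotC_pos_of_edge {U V : Set ℂ} (h : CircleColoring U V)
    (h0 : IsEdge U V 0 Complex.I) {R ν : ℂ} (hR : ‖R‖ = 1) (hx : 0 < R.re)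
    (hy : 4 * R.im ^ 2 < 1) (hν : IsEdge U V R ν) : 0 < dotC ν (Complex.I * R) := by
  by_contra! hk
  have hxy : R.re ^ 2 + R.im ^ 2 = 1 := by
    have := Complex.sq_norm R
    rw [hR, Complex.normSq_apply] at this
    linarith
  obtain ⟨s, hs, hsν⟩ := exists_sq_eq_three (-ν.re)
  have hnd := hν.nondegenerate hx.ne'
  obtain ⟨p, hp⟩ := h.exists_edge h0 hs hR hν hnd
  obtain ⟨α, β, hα, hβ, h1, h2, h3⟩ := h.exists_nonneg_combination h0 hs hR hν hnd hp
  simp [dotC, sixth] at h3 hk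
  rw [h1, h2] at h3
  set x := R.re
  set y := R.im
  have hsy : (s * y) ^ 2 < x ^ 2 := by rw [mul_pow, hs]; linarith
  have habs := abs_lt_of_sq_lt_sq' hsy hx.le
  have e1 : β * (ν.re * (s * x - y) + ν.im * (x + s * y)) = α * (x - s * y) := by
    linear_combination 2 * h3
  have e2 : x * (ν.re * (s * x - y) + ν.im * (x + s * y)) =
      ν.re * s + (x * ν.im - y * ν.re) * (x + s * y) := by
    linear_combination ν.re * s * hxy
  have hlt : ν.re * (s * x - y) + ν.im * (x + s * y) < 0 := by
    by_contra! hge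
    have h4 : 0 ≤ x * (ν.re * (s * x - y) + ν.im * (x + s * y)) := by positivity
    have h5 : (x * ν.im - y * ν.re) * (x + s * y) ≤ 0 :=
      mul_nonpos_of_nonpos_of_nonneg (by linarith) (by linarith)
    have h6 : s * ν.re = 0 := by linarith
    have hs0 : s ≠ 0 := by rintro rfl; norm_num at hs
    have h7 : ν.re = 0 := (mul_eq_zero.mp h6).resolve_left hs0
    have h8 : x * ν.im * (x + s * y) = 0 := by
      rw [h7] at h5 e2 h4
      linarith
    have h9 : ν.im = 0 := by
      simpa [hx.ne', (by linarith : x + s * y ≠ 0)] using h8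
    exact hν.1 (Complex.ext h7 h9)
  have h4 : 0 ≤ α * (x - s * y) := mul_nonneg hα (by linarith)
  have hβ0 : β = 0 := by
    by_contra hne
    have : 0 < β := lt_of_le_of_ne hβ (Ne.symm hne)
    nlinarith
  have hα0 : α = 0 := by
    rw [hβ0, zero_mul] at e1
    exact (mul_eq_zero.mp e1.symm).resolve_right (by linarith)
  exact hp.1 (Complex.ext (by simp [h1, hβ0]) (by simp [h2, hα0, hβ0]))

/-- A curve that starts in `U` and ends in `V` leaves `U` for good at a point outside both. -/
lemma exists_last_exit {U V : Set ℂ} (hU : IsOpen U) (hV : IsOpen V) (hd : Disjoint U V)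
    {γ : ℝ → ℂ} (hγ : Continuous γ) {a b : ℝ} (hab : a ≤ b) (ha : γ a ∈ U) (hb : γ b ∈ V) :
    ∃ c ∈ Set.Ioo a b, γ c ∉ U ∧ γ c ∉ V ∧ ∀ t ∈ Set.Ioc c b, γ t ∉ U := by
  set T := {t | t ∈ Set.Icc a b ∧ γ t ∈ U} with hT
  have haT : a ∈ T := ⟨⟨le_rfl, hab⟩, ha⟩
  have hbdd : BddAbove T := ⟨b, fun t ht => ht.1.2⟩
  set c := sSup T with hc
  have hac : a ≤ c := le_csSup hbdd haT
  have hcb : c ≤ b := csSup_le ⟨a, haT⟩ fun t ht => ht.1.2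
  have hafter : ∀ t ∈ Set.Ioc c b, γ t ∉ U := fun t ht hm =>
    absurd (le_csSup hbdd ⟨⟨hac.trans ht.1.le, ht.2⟩, hm⟩ : t ≤ c) (not_le.mpr ht.1)
  have hcU : γ c ∉ U := by
    intro hm
    have hcb' : c < b := lt_of_le_of_ne hcb fun e =>
      Set.disjoint_left.mp hd hm (by rw [e]; exact hb)
    have h1 : ∀ᶠ t in 𝓝[>] c, γ t ∈ U :=
      (hγ.continuousAt.eventually (hU.mem_nhds hm)).filter_mono nhdsWithin_le_nhds
    obtain ⟨t, h2, h3⟩ := (h1.and (Ioc_mem_nhdsGT hcb')).exists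
    exact hafter t h3 h2
  have hcV : γ c ∉ V := by
    intro hm
    have hn : γ ⁻¹' V ∈ 𝓝 c := hγ.continuousAt.preimage_mem_nhds (hV.mem_nhds hm)
    obtain ⟨t, h1, h2⟩ := mem_closure_iff_nhds.mp (csSup_mem_closure ⟨a, haT⟩ hbdd) _ hn
    exact Set.disjoint_left.mp hd h2.2 h1
  refine ⟨c, ⟨lt_of_le_of_ne hac ?_, lt_of_le_of_ne hcb ?_⟩, hcU, hcV, hafter⟩
  · rintro e; exact hcU (by rw [← e]; exact ha)
  · rintro e; exact hcV (by rw [e]; exact hb)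

lemma IsEdge.notMem_right {U V : Set ℂ} (hU : IsOpen U) (hV : IsOpen V) (hd : Disjoint U V)
    {P ν : ℂ} (h : IsEdge U V P ν) : P ∉ V := by
  intro hP
  have hγ : HasDerivAt (fun t : ℝ => P + (t : ℂ) * ν) ν 0 := by
    have := ((hasDerivAt_id (0 : ℝ)).ofReal_comp.mul_const ν).const_add P
    simpa using this
  have hpos : 0 < dotC ν ν := by
    have := Complex.normSq_pos.mpr h.1
    rwa [Complex.normSq_apply] at this
  have h1 := Toward.eventually_mem hU (γ := fun t : ℝ => P + (t : ℂ) * ν)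
    (by rw [Complex.ofReal_zero, zero_mul, add_zero]; exact Or.inr ⟨ν, h, hpos⟩) hγ
  have h2 := Toward.eventually_mem (V := U) hV (γ := fun t : ℝ => P + (t : ℂ) * ν)
    (by rw [Complex.ofReal_zero, zero_mul, add_zero]; exact Or.inl hP) hγ
  obtain ⟨t, h1, h2⟩ := (h1.and h2).exists
  exact Set.disjoint_left.mp hd h1 h2

lemma CircleColoring.I_mem {U V : Set ℂ} (h : CircleColoring U V)
    (h0 : IsEdge U V 0 Complex.I) : Complex.I ∈ U ∨ Complex.I ∈ V := by
  rcases h.local_edge Complex.I (by simp) with h1 | h1 | ⟨ν, hν⟩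
  · exact Or.inl h1
  · exact Or.inr h1
  exfalso
  have h3 : √3 ^ 2 = (3 : ℝ) := Real.sq_sqrt (by norm_num)
  have h3' : (-√3) ^ 2 = (3 : ℝ) := by rw [neg_sq, h3]
  have hpos : 0 < √3 := by positivity
  set P : ℂ := ⟨√3 / 2, 1 / 2⟩ with hP
  set Q : ℂ := ⟨√3 / 2, -(1 / 2)⟩ with hQ
  have hPV : P ∈ V := by
    have e : sixth (-√3) * Complex.I = P := by apply Complex.ext <;> simp [sixth, hP, neg_div]
    exact e ▸ h.sixth_mul_I_mem h0 hν h3'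
  have hQ1 : ‖Q‖ = 1 := norm_eq_one_of_sq (by nlinarith)
  have hPQ : sixth √3 * Q = P := by
    apply Complex.ext <;> simp [sixth, hP, hQ] <;> nlinarith
  have hQU : Q ∈ U := by
    rcases h.local_edge Q hQ1 with h1 | h1 | ⟨p, hp⟩
    · exact h1
    · exact (h.symm.not_toward h3 hQ1 ⟨0, -1⟩ 0 (toward_of_im_neg h0 (by simp)) (Or.inl h1)
        (Or.inl (by rwa [hPQ]))).elim
    · exfalso
      have hnd := hp.nondegenerate (by simp [hQ])
      obtain ⟨p', hp'⟩ := h.exists_edge h0 h3 hQ1 hp hnd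
      rw [hPQ] at hp'
      exact hp'.notMem_right h.isOpen_left h.isOpen_right h.disjoint hPV
  have hre : ∀ t, (spin 1 1 t).re = Real.cos t := fun t => by
    simp [spin, Complex.exp_ofReal_mul_I_re]
  have him : ∀ t, (spin 1 1 t).im = Real.sin t := fun t => by
    simp [spin, Complex.exp_ofReal_mul_I_im]
  have hγ : Continuous (spin 1 1) :=
    continuous_iff_continuousAt.mpr fun t => (hasDerivAt_spin 1 1 t).continuousAt
  have hγa : spin 1 1 (-(Real.pi / 6)) = Q := by
    apply Complex.ext <;> simp [hre, him, hQ]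
  have hγb : spin 1 1 (Real.pi / 6) = P := by
    apply Complex.ext <;> simp [hre, him, hP]
  have hπ := Real.pi_pos
  obtain ⟨c, hc, hcU, hcV, hafter⟩ := exists_last_exit h.isOpen_left h.isOpen_right h.disjoint hγ
    (by linarith : -(Real.pi / 6) ≤ Real.pi / 6) (hγa ▸ hQU) (hγb ▸ hPV)
  have hc1 : ‖spin 1 1 c‖ = 1 := by rw [norm_spin, norm_one]
  obtain ⟨p, hp⟩ := ((h.local_edge _ hc1).resolve_left hcU).resolve_left hcV
  have hsin1 : Real.sin c < 1 / 2 := by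
    rw [← Real.sin_pi_div_six]
    exact Real.sin_lt_sin_of_lt_of_le_pi_div_two (by linarith [hc.1]) (by linarith) hc.2
  have hsin2 : -(1 / 2) < Real.sin c := by
    rw [← Real.sin_pi_div_six, ← Real.sin_neg]
    exact Real.sin_lt_sin_of_lt_of_le_pi_div_two (by linarith) (by linarith [hc.2]) hc.1
  have hpos := h.dotC_pos_of_edge h0 hc1
    (by rw [hre]; exact Real.cos_pos_of_mem_Ioo ⟨by linarith [hc.1], by linarith [hc.2]⟩)
    (by rw [him]; nlinarith) hp
  have hev := Toward.eventually_mem h.isOpen_left (Or.inr ⟨p, hp, by simpa using hpos⟩)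
    (hasDerivAt_spin 1 1 c)
  obtain ⟨t, h1, h2⟩ := (hev.and (Ioc_mem_nhdsGT hc.2)).exists
  exact hafter t h2 h1

section Local

variable {E : Type*} [NormedAddCommGroup E] [InnerProductSpace ℝ E]

lemma IsPreconnected.subset_interior_or_of_disjoint_frontier {X : Type*} [TopologicalSpace X]
    {B C : Set X} (hC : IsPreconnected C) (hd : ∀ q ∈ C, q ∉ frontier B) :
    C ⊆ interior B ∨ C ⊆ interior Bᶜ := by
  refine hC.subset_or_subset isOpen_interior isOpen_interior
    (disjoint_compl_right.mono interior_subset interior_subset) fun q hq => ?_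
  by_contra hn
  rw [Set.mem_union, not_or, interior_compl, Set.notMem_compl_iff] at hn
  exact hd q hq ⟨hn.2, hn.1⟩

/-- If `B` contains both sides of a hyperplane near `P`, and its complement is contained in the
closure of the interior of the complement, then `P` is interior to `B`. -/
lemma mem_interior_of_sides_subset {B : Set E} (hB : Bᶜ ⊆ closure (interior Bᶜ)) {P ν : E}
    (hν : ν ≠ 0) {r : ℝ} (hr : 0 < r)
    (hpos : ∀ q ∈ Metric.ball P r, 0 < ⟪ν, q - P⟫ → q ∈ interior B)
    (hneg : ∀ q ∈ Metric.ball P r, ⟪ν, q - P⟫ < 0 → q ∈ interior B) : P ∈ interior B := by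
  refine mem_interior.mpr ⟨Metric.ball P r, fun q hq => ?_, Metric.isOpen_ball,
    Metric.mem_ball_self hr⟩
  by_contra hqB
  obtain ⟨q', hq'r, hq'⟩ := mem_closure_iff.mp (hB hqB) _ Metric.isOpen_ball hq
  have hzero : ⟪ν, q' - P⟫ = 0 := by
    rcases lt_trichotomy ⟪ν, q' - P⟫ 0 with h | h | h
    · exact absurd (interior_subset (hneg q' hq'r h)) (interior_subset hq')
    · exact h
    · exact absurd (interior_subset (hpos q' hq'r h)) (interior_subset hq')
  have hc : Tendsto (fun t : ℝ => q' + t • ν) (𝓝[>] 0) (𝓝 q') := by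
    have : Continuous fun t : ℝ => q' + t • ν := by fun_prop
    simpa using (this.tendsto 0).mono_left (nhdsWithin_le_nhds (s := Set.Ioi 0))
  have hopen : Metric.ball P r ∩ interior Bᶜ ∈ 𝓝 q' :=
    (Metric.isOpen_ball.inter isOpen_interior).mem_nhds ⟨hq'r, hq'⟩
  obtain ⟨t, ⟨h1, h2⟩, h3⟩ := ((hc.eventually hopen).and self_mem_nhdsWithin).exists
  have hin : 0 < ⟪ν, q' + t • ν - P⟫ := by
    rw [add_sub_right_comm, inner_add_right, hzero, zero_add, inner_smul_right]
    exact mul_pos h3 (real_inner_self_pos.mpr hν)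
  exact absurd (interior_subset (hpos _ h1 hin)) (interior_subset h2)

/-- If the frontier of `B` is contained in a hyperplane near one of its points, then `B` and its
complement occupy the two sides of this hyperplane. -/
lemma eventually_sides {B : Set E} (hB : B ⊆ closure (interior B))
    (hW : Bᶜ ⊆ closure (interior Bᶜ)) {P ν : E} (hP : P ∈ frontier B) (hν : ν ≠ 0)
    (hfr : ∀ᶠ q in 𝓝 P, q ∈ frontier B → ⟪ν, q - P⟫ = 0) :
    (∀ᶠ q in 𝓝 P, (0 < ⟪ν, q - P⟫ → q ∈ interior B) ∧ (⟪ν, q - P⟫ < 0 → q ∈ interior Bᶜ)) ∨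
    (∀ᶠ q in 𝓝 P, (0 < ⟪ν, q - P⟫ → q ∈ interior Bᶜ) ∧ (⟪ν, q - P⟫ < 0 → q ∈ interior B)) := by
  obtain ⟨r, hr, hball⟩ := Metric.eventually_nhds_iff_ball.mp hfr
  have hlin : IsLinearMap ℝ (fun q : E => ⟪ν, q⟫) := (innerₛₗ ℝ ν).isLinear
  have e : ∀ q, ⟪ν, q - P⟫ = ⟪ν, q⟫ - ⟪ν, P⟫ := fun q => inner_sub_right _ _ _
  have h1 : Convex ℝ (Metric.ball P r ∩ {q | ⟪ν, P⟫ < ⟪ν, q⟫}) :=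
    (convex_ball P r).inter (convex_halfSpace_gt hlin _)
  have h2 : Convex ℝ (Metric.ball P r ∩ {q | ⟪ν, q⟫ < ⟪ν, P⟫}) :=
    (convex_ball P r).inter (convex_halfSpace_lt hlin _)
  have h1' := h1.isPreconnected.subset_interior_or_of_disjoint_frontier (B := B)
    fun q hq hqB => by
      have := hball q hq.1 hqB
      rw [e] at this
      exact absurd hq.2 (by simp; linarith)
  have h2' := h2.isPreconnected.subset_interior_or_of_disjoint_frontier (B := B)
    fun q hq hqB => by
      have := hball q hq.1 hqB
      rw [e] at this
      exact absurd hq.2 (by simp; linarith)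
  have hmem : Metric.ball P r ∈ 𝓝 P := Metric.ball_mem_nhds P hr
  simp only [e, sub_pos, sub_neg]
  rcases h1' with h1' | h1' <;> rcases h2' with h2' | h2'
  · refine absurd (mem_interior_of_sides_subset hW hν hr (fun q hq h => h1' ⟨hq, ?_⟩)
      (fun q hq h => h2' ⟨hq, ?_⟩)) hP.2
    · rwa [e, sub_pos] at h
    · rwa [e, sub_neg] at h
  · left
    filter_upwards [hmem] with q hq using ⟨fun h => h1' ⟨hq, h⟩, fun h => h2' ⟨hq, h⟩⟩
  · right
    filter_upwards [hmem] with q hq using ⟨fun h => h1' ⟨hq, h⟩, fun h => h2' ⟨hq, h⟩⟩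
  · rw [← frontier_compl] at hP
    refine absurd (mem_interior_of_sides_subset (B := Bᶜ) (by rwa [compl_compl]) hν hr
      (fun q hq h => h1' ⟨hq, ?_⟩) (fun q hq h => h2' ⟨hq, ?_⟩)) hP.2
    · rwa [e, sub_pos] at h
    · rwa [e, sub_neg] at h

end Local

/-- Near a boundary point that is not a vertex, the boundary is contained in a single segment. -/
lemma IsPolygonal.eventually_mem_segment {B : Set (EuclideanSpace ℝ (Fin 2))}
    {S : Set (Set (EuclideanSpace ℝ (Fin 2)))} (h : IsPolygonal B S)
    {P : EuclideanSpace ℝ (Fin 2)} (hP : ¬IsVertex S P) {t : Set (EuclideanSpace ℝ (Fin 2))}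
    (ht : t ∈ S) (hPt : P ∈ t) : ∀ᶠ q in 𝓝 P, q ∈ frontier B → q ∈ t := by
  have hfin := (h.loc_finite _ (Metric.isBounded_ball (x := P) (r := 1))).subset
    (Set.sdiff_subset (t := {t}))
  have hcl := hfin.isClosed_biUnion (f := id) fun u hu => (h.seg u hu.1.1).1
  have hnot : P ∉ ⋃ u ∈ {s ∈ S | (s ∩ Metric.ball P 1).Nonempty} \ {t}, id u := by
    simp only [Set.mem_iUnion, not_exists]
    intro u hu hPu
    exact hP ⟨u, hu.1.1, (h.inter_endpoint u hu.1.1 t ht hu.2 P ⟨hPu, hPt⟩).1⟩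
  filter_upwards [hcl.isOpen_compl.mem_nhds hnot, Metric.ball_mem_nhds P one_pos] with q hq hq1 hqB
  rw [h.boundary] at hqB
  obtain ⟨u, hu, hqu⟩ := hqB
  by_contra hqt
  refine hq (Set.mem_biUnion (x := u) ⟨⟨hu, q, hqu, hq1⟩, ?_⟩ hqu)
  rintro rfl
  exact hqt hqu

lemma IsLine.exists_normal {l : AffineSubspace ℝ (EuclideanSpace ℝ (Fin 2))} (hl : IsLine l) :
    ∃ ν : EuclideanSpace ℝ (Fin 2), ν ≠ 0 ∧ ∀ v ∈ l.direction, ⟪ν, v⟫ = 0 := by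
  have hne : l.directionᗮ ≠ ⊥ := by
    intro h
    have h1 := l.direction.finrank_add_finrank_orthogonal
    rw [h, hl.2] at h1
    simp at h1
  obtain ⟨ν, hν, hν0⟩ := Submodule.exists_mem_ne_zero_of_ne_bot hne
  exact ⟨ν, hν0, fun v hv => Submodule.inner_left_of_mem_orthogonal hv hν⟩

lemma IsPolygonal.eventually_sides_of_normal {B : Set (EuclideanSpace ℝ (Fin 2))}
    {S : Set (Set (EuclideanSpace ℝ (Fin 2)))} (h : IsPolygonal B S)
    {P : EuclideanSpace ℝ (Fin 2)} (hP : ¬IsVertex S P) {t : Set (EuclideanSpace ℝ (Fin 2))}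
    (ht : t ∈ S) (hPt : P ∈ t) {l : AffineSubspace ℝ (EuclideanSpace ℝ (Fin 2))}
    (htl : t ⊆ (l : Set _)) {ν : EuclideanSpace ℝ (Fin 2)} (hν : ν ≠ 0)
    (hνl : ∀ v ∈ l.direction, ⟪ν, v⟫ = 0) :
    (∀ᶠ q in 𝓝 P, (0 < ⟪ν, q - P⟫ → q ∈ interior B) ∧ (⟪ν, q - P⟫ < 0 → q ∈ interior Bᶜ)) ∨
    (∀ᶠ q in 𝓝 P, (0 < ⟪ν, q - P⟫ → q ∈ interior Bᶜ) ∧ (⟪ν, q - P⟫ < 0 → q ∈ interior B)) := by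
  refine eventually_sides h.black_sub h.white_sub ?_ hν
    ((h.eventually_mem_segment hP ht hPt).mono fun q hq hqB => ?_)
  · rw [h.boundary]; exact ⟨t, ht, hPt⟩
  · exact hνl _ (AffineSubspace.vsub_mem_direction (htl (hq hqB)) (htl hPt))

/-- The point with coordinates `z` in the orthonormal frame at `A` whose second vector is `n`. -/
def frame (A n : EuclideanSpace ℝ (Fin 2)) (z : ℂ) : EuclideanSpace ℝ (Fin 2) :=
  A + (z.re • !₂[n 1, -n 0] + z.im • n)

lemma continuous_frame (A n : EuclideanSpace ℝ (Fin 2)) : Continuous (frame A n) := by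
  unfold frame
  fun_prop

lemma dist_frame (A : EuclideanSpace ℝ (Fin 2)) {n : EuclideanSpace ℝ (Fin 2)} (hn : ‖n‖ = 1)
    (z w : ℂ) : dist (frame A n z) (frame A n w) = dist z w := by
  have hn2 : n 0 ^ 2 + n 1 ^ 2 = 1 := by
    have := EuclideanSpace.real_norm_sq_eq n
    rw [hn, Fin.sum_univ_two] at this
    linarith
  rw [EuclideanSpace.dist_eq, Complex.dist_eq, Complex.norm_eq_sqrt_sq_add_sq]
  congr 1
  simp only [Fin.sum_univ_two, Real.dist_eq, sq_abs, frame]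
  simp
  linear_combination ((z.re - w.re) ^ 2 + (z.im - w.im) ^ 2) * hn2

/-- The coordinates of a direction in the frame used by `frame`. -/
def frameDir (n ν : EuclideanSpace ℝ (Fin 2)) : ℂ := ⟨⟪ν, !₂[n 1, -n 0]⟫, ⟪ν, n⟫⟩

lemma inner_frame_sub (A n ν : EuclideanSpace ℝ (Fin 2)) (z w : ℂ) :
    ⟪ν, frame A n z - frame A n w⟫ = dotC (frameDir n ν) (z - w) := by
  simp [frame, frameDir, dotC, inner_add_right, inner_sub_right, inner_smul_right]
  ring

lemma frameDir_ne_zero {n ν : EuclideanSpace ℝ (Fin 2)} (hn : ‖n‖ = 1) (hν : ν ≠ 0) :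
    frameDir n ν ≠ 0 := by
  have hn2 : n 0 ^ 2 + n 1 ^ 2 = 1 := by
    have := EuclideanSpace.real_norm_sq_eq n
    rw [hn, Fin.sum_univ_two] at this
    linarith
  intro h
  have h1 : n 1 * ν 0 - n 0 * ν 1 = 0 := by
    have := congrArg Complex.re h
    simp [frameDir, PiLp.inner_apply] at this
    linarith
  have h2 : n 0 * ν 0 + n 1 * ν 1 = 0 := by
    have := congrArg Complex.im h
    simpa [frameDir, PiLp.inner_apply] using this
  apply hν
  ext i
  fin_cases i
  · simp
    linear_combination n 1 * h1 + n 0 * h2 - ν 0 * hn2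
  · simp
    linear_combination n 1 * h2 - n 0 * h1 - ν 1 * hn2

lemma frameDir_self {n : EuclideanSpace ℝ (Fin 2)} (hn : ‖n‖ = 1) :
    frameDir n n = Complex.I := by
  apply Complex.ext
  · simp [frameDir, PiLp.inner_apply]
    ring
  · simp [frameDir, hn]

lemma isEdge_frame {C D : Set (EuclideanSpace ℝ (Fin 2))} {A n ν : EuclideanSpace ℝ (Fin 2)}
    (hn : ‖n‖ = 1) (hν : ν ≠ 0) {z : ℂ}
    (h : ∀ᶠ q in 𝓝 (frame A n z), (0 < ⟪ν, q - frame A n z⟫ → q ∈ C) ∧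
      (⟪ν, q - frame A n z⟫ < 0 → q ∈ D)) :
    IsEdge (frame A n ⁻¹' C) (frame A n ⁻¹' D) z (frameDir n ν) := by
  refine ⟨frameDir_ne_zero hn hν, ?_⟩
  filter_upwards [(continuous_frame A n).continuousAt.eventually h] with q hq
  rwa [inner_frame_sub] at hq

lemma mem_interior_or_frontier {X : Type*} [TopologicalSpace X] (B : Set X) (q : X) :
    q ∈ interior B ∨ q ∈ interior Bᶜ ∨ q ∈ frontier B := by
  by_contra! hc
  have h2 := hc.2.1
  rw [interior_compl, Set.notMem_compl_iff] at h2
  exact hc.2.2 ⟨h2, hc.1⟩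

lemma IsPolygonal.circleColoring {B : Set (EuclideanSpace ℝ (Fin 2))}
    {S : Set (Set (EuclideanSpace ℝ (Fin 2)))} (h : IsPolygonal B S) (hC3 : C3 B)
    {A n : EuclideanSpace ℝ (Fin 2)} (hn : ‖n‖ = 1)
    (hA : ∀ P ∈ Metric.sphere A 1, ¬IsVertex S P) :
    CircleColoring (frame A n ⁻¹' interior B) (frame A n ⁻¹' interior Bᶜ) where
  isOpen_left := isOpen_interior.preimage (continuous_frame A n)
  isOpen_right := isOpen_interior.preimage (continuous_frame A n)
  disjoint := (disjoint_compl_right.mono interior_subset interior_subset).preimage _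
  left_free X hX Y hY Z hZ h1 h2 h3 := by
    rw [← dist_frame A hn] at h1 h2 h3
    rcases hC3 _ _ _ h1 h2 h3
      (Or.inl ⟨interior_subset hX, interior_subset hY, interior_subset hZ⟩) with h | h | h
    · exact h.2 hX
    · exact h.2 hY
    · exact h.2 hZ
  right_free X hX Y hY Z hZ h1 h2 h3 := by
    rw [← dist_frame A hn] at h1 h2 h3
    rcases hC3 _ _ _ h1 h2 h3
      (Or.inr ⟨interior_subset hX, interior_subset hY, interior_subset hZ⟩) with h | h | h <;>
      rw [← frontier_compl] at h
    · exact h.2 hX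
    · exact h.2 hY
    · exact h.2 hZ
  local_edge z hz := by
    rcases mem_interior_or_frontier B (frame A n z) with h1 | h1 | h1
    · exact Or.inl h1
    · exact Or.inr (Or.inl h1)
    · right; right
      have hs : frame A n z ∈ Metric.sphere A 1 := by
        have := dist_frame A hn z 0
        simpa [frame, hz] using this
      have h2 := h1
      rw [h.boundary] at h2
      obtain ⟨t, ht, hzt⟩ := h2
      obtain ⟨-, -, -, l, hl, htl⟩ := h.seg t ht
      obtain ⟨ν, hν, hνl⟩ := hl.exists_normal
      rcases h.eventually_sides_of_normal (hA _ hs) ht hzt htl hν hνl with h3 | h3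
      · exact ⟨_, isEdge_frame hn hν h3⟩
      · exact ⟨_, (isEdge_frame hn hν h3).symm⟩

lemma add_normal_notMem_frontier {B : Set (EuclideanSpace ℝ (Fin 2))}
    {S : Set (Set (EuclideanSpace ℝ (Fin 2)))} (hpoly : IsPolygonal B S) (hC3 : C3 B)
    {A : EuclideanSpace ℝ (Fin 2)} (hA : Feasible B S A)
    {s : Set (EuclideanSpace ℝ (Fin 2))} (hs : s ∈ S) (hAs : A ∈ s)
    {n : EuclideanSpace ℝ (Fin 2)} (hn : ‖n‖ = 1)
    {l : AffineSubspace ℝ (EuclideanSpace ℝ (Fin 2))} (hsl : s ⊆ (l : Set _))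
    (hnl : ∀ v ∈ l.direction, ⟪n, v⟫ = 0) : A + n ∉ frontier B := by
  have hcol := hpoly.circleColoring hC3 hn hA.2.2
  have hn0 : n ≠ 0 := by rintro rfl; simp at hn
  have hA0 : frame A n 0 = A := by simp [frame]
  have hI : frame A n Complex.I = A + n := by simp [frame]
  rw [← hI]
  have key : Complex.I ∈ frame A n ⁻¹' interior B ∨ Complex.I ∈ frame A n ⁻¹' interior Bᶜ := by
    have hsides := hpoly.eventually_sides_of_normal hA.2.1 hs hAs hsl hn0 hnl
    rw [← hA0] at hsides
    rcases hsides with h | h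
    · exact hcol.I_mem (frameDir_self hn ▸ isEdge_frame hn hn0 (hA0.symm ▸ h))
    · exact (hcol.symm.I_mem (frameDir_self hn ▸ isEdge_frame hn hn0 (hA0.symm ▸ h))).symm
  rcases key with h | h
  · exact fun hf => hf.2 h
  · rw [← frontier_compl]
    exact fun hf => hf.2 h

theorem stmt14 (B : Set (EuclideanSpace ℝ (Fin 2))) (S : Set (Set (EuclideanSpace ℝ (Fin 2))))
    (hpoly : IsPolygonal B S) (hC3 : C3 B)
    (A : EuclideanSpace ℝ (Fin 2)) (hA : Feasible B S A)
    (s : Set (EuclideanSpace ℝ (Fin 2))) (hs : s ∈ S) (hAs : A ∈ s)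
    (n : EuclideanSpace ℝ (Fin 2)) (hn : ‖n‖ = 1)
    (horth : ∃ l : AffineSubspace ℝ (EuclideanSpace ℝ (Fin 2)),
      IsLine l ∧ s ⊆ (l : Set _) ∧ ∀ v ∈ l.direction, ⟪n, v⟫ = 0) :
    A + n ∉ frontier B ∧ A - n ∉ frontier B := by
  obtain ⟨l, -, hsl, hnl⟩ := horth
  refine ⟨add_normal_notMem_frontier hpoly hC3 hA hs hAs hn hsl hnl, ?_⟩
  rw [sub_eq_add_neg]
  exact add_normal_notMem_frontier hpoly hC3 hA hs hAs (by rwa [norm_neg]) hsl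
    fun v hv => by rw [inner_neg_left, hnl v hv, neg_zero]

end
end
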